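/- arXiv:1510.05986 — 8 statements merged into one kernel-verified Lean document; each statement's English description precedes it below -/
import Mathlib

section
/- Let V be a complex vector space of finite dimension N ≥ 1 equipped with a nondegenerate symmetric bilinear form B, and let x : V → V be a nilpotent linear endomorphism that is B-self-adjoint. Then there exist an integer s ≥ 1, integers λ₁ ≥ λ₂ ≥ … ≥ λ_s ≥ 1 with λ₁ + … + λ_s = N, and vectors v₁, …, v_s ∈ V such that: x^{λ_i} v_i = 0 for each i; the family (x^a v_i) for 1 ≤ i ≤ s and 0 ≤ a ≤ λ_i − 1 is a basis of V; and B(x^a v_i, x^b v_j) equals 1 if i = j and a + b = λ_i − 1, and equals 0 otherwise. -/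
open Module

section SelfAdjointNilpotent

variable {K V : Type*} [Field K] [AddCommGroup V] [Module K V]
  {B : V →ₗ[K] V →ₗ[K] K} {x : Module.End K V}

lemma bilin_pow_apply_comm (hsa : ∀ u v, B (x u) v = B u (x v)) (a : ℕ) (u v : V) :
    B ((x ^ a) u) v = B u ((x ^ a) v) := by
  induction a generalizing u v with
  | zero => simp
  | succ n ih => rw [pow_succ, Module.End.mul_apply, ih, hsa, ← Module.End.mul_apply, ← pow_succ',
      pow_succ]

lemma bilin_pow_pow_apply (hsa : ∀ u v, B (x u) v = B u (x v)) (a c : ℕ) (u v : V) :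
    B ((x ^ a) u) ((x ^ c) v) = B ((x ^ (a + c)) u) v := by
  rw [← bilin_pow_apply_comm hsa, ← Module.End.mul_apply, ← pow_add, add_comm]

lemma pow_apply_mem {W : Submodule K V} (hW : ∀ w ∈ W, x w ∈ W) (a : ℕ) {w : V} (hw : w ∈ W) :
    (x ^ a) w ∈ W := by
  induction a with
  | zero => simpa
  | succ n ih => rw [pow_succ', Module.End.mul_apply]; exact hW _ ih

lemma pow_apply_eq_zero_of_le {n a : ℕ} {u : V} (hu : (x ^ n) u = 0) (h : n ≤ a) :
    (x ^ a) u = 0 := by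
  rw [← Nat.sub_add_cancel h, pow_add, Module.End.mul_apply, hu, map_zero]

lemma exists_mem_bilin_pow_apply_self_eq_one [IsAlgClosed K] [NeZero (2 : K)]
    (hsymm : ∀ u v, B u v = B v u) (hsa : ∀ u v, B (x u) v = B u (x v)) {W : Submodule K V}
    (hW : ∀ w ∈ W, x w ∈ W) (hnd : ∀ v ∈ W, (∀ w ∈ W, B v w = 0) → v = 0)
    {n : ℕ} (hn : ∃ w ∈ W, (x ^ n) w ≠ 0) :
    ∃ v ∈ W, B ((x ^ n) v) v = 1 := by
  obtain ⟨u, hu, hne⟩ : ∃ u ∈ W, B ((x ^ n) u) u ≠ 0 := by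
    by_contra! h
    obtain ⟨w, hw, hne⟩ := hn
    refine hne (hnd _ (pow_apply_mem hW n hw) fun u hu => ?_)
    have key := h _ (W.add_mem hw hu)
    have hs : B ((x ^ n) u) w = B ((x ^ n) w) u := by
      rw [bilin_pow_apply_comm hsa, hsymm]
    simp only [map_add, LinearMap.add_apply, h w hw, h u hu, hs, zero_add, add_zero] at key
    rw [← two_mul] at key
    exact (mul_eq_zero.mp key).resolve_left two_ne_zero
  obtain ⟨z, hz⟩ := IsAlgClosed.exists_pow_nat_eq (B ((x ^ n) u) u)⁻¹ two_pos
  refine ⟨z • u, W.smul_mem z hu, ?_⟩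
  simp only [map_smul, LinearMap.smul_apply, smul_eq_mul]
  rw [← mul_assoc, ← sq, hz, inv_mul_cancel₀ hne]

/-- A vector of maximal height on which the top form `B (x ^ n u) u` does not vanish can be
corrected so that all the lower forms vanish on it. -/
lemma exists_mem_bilin_pow_apply_self [IsAlgClosed K] [NeZero (2 : K)]
    (hsymm : ∀ u v, B u v = B v u) (hsa : ∀ u v, B (x u) v = B u (x v)) {W : Submodule K V}
    (hW : ∀ w ∈ W, x w ∈ W) (hnd : ∀ v ∈ W, (∀ w ∈ W, B v w = 0) → v = 0)
    {n : ℕ} (hn : ∃ w ∈ W, (x ^ n) w ≠ 0) (hz : ∀ w ∈ W, (x ^ (n + 1)) w = 0) :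
    ∃ v ∈ W, ∀ a, B ((x ^ a) v) v = if a = n then 1 else 0 := by
  have hbig : ∀ u ∈ W, ∀ a, n < a → B ((x ^ a) u) u = 0 := fun u hu a ha => by
    rw [pow_apply_eq_zero_of_le (hz u hu) ha, map_zero, LinearMap.zero_apply]
  suffices H : ∀ m, ∃ v ∈ W, ∀ a, n ≤ a + m → B ((x ^ a) v) v = if a = n then 1 else 0 by
    obtain ⟨v, hv, h⟩ := H n
    exact ⟨v, hv, fun a => h a (Nat.le_add_left _ _)⟩
  intro m
  induction m with
  | zero =>
    obtain ⟨v, hv, h⟩ := exists_mem_bilin_pow_apply_self_eq_one hsymm hsa hW hnd hn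
    refine ⟨v, hv, fun a ha => ?_⟩
    split_ifs with han
    · rw [han, h]
    · exact hbig v hv a (by omega)
  | succ m ih =>
    obtain ⟨u, hu, h⟩ := ih
    by_cases hm : n < m + 1
    · exact ⟨u, hu, fun a _ => h a (by omega)⟩
    set c : K := -(B ((x ^ (n - (m + 1))) u) u) / 2 with hc
    have hexp : ∀ a, B ((x ^ a) (u + c • (x ^ (m + 1)) u)) (u + c • (x ^ (m + 1)) u) =
        B ((x ^ a) u) u + 2 * c * B ((x ^ (a + (m + 1))) u) u +
          c ^ 2 * B ((x ^ (a + (m + 1) + (m + 1))) u) u := fun a => by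
      simp only [map_add, map_smul, LinearMap.add_apply, LinearMap.smul_apply, smul_eq_mul,
        ← Module.End.mul_apply (x ^ a), ← pow_add, bilin_pow_pow_apply hsa]
      ring
    refine ⟨u + c • (x ^ (m + 1)) u,
      W.add_mem hu (W.smul_mem c (pow_apply_mem hW _ hu)), fun a ha => ?_⟩
    rw [hexp, hbig u hu (a + (m + 1) + (m + 1)) (by omega)]
    rcases eq_or_lt_of_le ha with ha | ha
    · rw [← ha, h n (by omega), if_pos rfl, if_neg (by omega), hc,
        show n - (m + 1) = a by omega]
      field_simp
      ring
    · rw [hbig u hu _ ha, h a (by omega)]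
      ring

/-- Splitting off cyclic summands of maximal height from an invariant nondegenerate subspace. -/
lemma exists_orthogonal_cyclic_generators [IsAlgClosed K] [NeZero (2 : K)]
    [FiniteDimensional K V]
    (hsymm : ∀ u v, B u v = B v u) (hsa : ∀ u v, B (x u) v = B u (x v)) (hnil : IsNilpotent x)
    (W : Submodule K V)
    (hW : ∀ w ∈ W, x w ∈ W) (hnd : ∀ v ∈ W, (∀ w ∈ W, B v w = 0) → v = 0) :
    ∃ (s : ℕ) (lam : Fin s → ℕ) (v : Fin s → V), Antitone lam ∧ (∀ i, 1 ≤ lam i) ∧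
      (∀ i, v i ∈ W) ∧ (∀ i, (x ^ lam i) (v i) = 0) ∧
      (∀ i j a, B ((x ^ a) (v i)) (v j) = if i = j ∧ a + 1 = lam i then 1 else 0) ∧
      W ≤ Submodule.span K
        (Set.range fun p : (i : Fin s) × Fin (lam i) => (x ^ (p.2 : ℕ)) (v p.1)) := by
  induction hd : finrank K W using Nat.strong_induction_on generalizing W with
  | _ d ih =>
  subst hd
  by_cases hbot : W = ⊥
  · subst hbot
    exact ⟨0, Fin.elim0, Fin.elim0, fun i => i.elim0, fun i => i.elim0, fun i => i.elim0,
      fun i => i.elim0, fun i => i.elim0, bot_le⟩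
  obtain ⟨n, hn, hz⟩ : ∃ n, (∃ w ∈ W, (x ^ n) w ≠ 0) ∧ ∀ w ∈ W, (x ^ (n + 1)) w = 0 := by
    classical
    have hex : ∃ k, ∀ w ∈ W, (x ^ k) w = 0 := by
      obtain ⟨k, hk⟩ := hnil
      exact ⟨k, fun w _ => by rw [hk, LinearMap.zero_apply]⟩
    obtain ⟨w, hw, hw0⟩ := W.ne_bot_iff.mp hbot
    have hpos : Nat.find hex ≠ 0 := fun h0 => hw0 (by simpa [h0] using Nat.find_spec hex w hw)
    refine ⟨Nat.find hex - 1, ?_, ?_⟩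
    · simpa using Nat.find_min hex (m := Nat.find hex - 1) (by omega)
    · rw [Nat.sub_add_cancel (by omega)]
      exact Nat.find_spec hex
  obtain ⟨u, hu, hgram⟩ := exists_mem_bilin_pow_apply_self hsymm hsa hW hnd hn hz
  let W' : Submodule K V := W ⊓ ⨅ a : ℕ, LinearMap.ker (B ((x ^ a) u))
  have hmem : ∀ w, w ∈ W' ↔ w ∈ W ∧ ∀ a, B ((x ^ a) u) w = 0 := fun w => by
    simp [W', Submodule.mem_iInf]
  have hle : W' ≤ W := inf_le_left
  have hlt : W' < W := by
    refine lt_of_le_of_ne hle fun h => ?_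
    have := ((hmem u).mp (h ▸ hu)).2 n
    rw [hgram, if_pos rfl] at this
    exact one_ne_zero this
  have hW' : ∀ w ∈ W', x w ∈ W' := fun w hw => by
    rw [hmem] at hw ⊢
    refine ⟨hW w hw.1, fun a => ?_⟩
    rw [← hsa, ← Module.End.mul_apply, ← pow_succ']
    exact hw.2 _
  have hproj : ∀ w ∈ W,
      w - ∑ a : Fin (n + 1), B ((x ^ (n - a)) u) w • (x ^ (a : ℕ)) u ∈ W' := fun w hw => by
    rw [hmem]
    refine ⟨W.sub_mem hw (W.sum_mem fun a _ => W.smul_mem _ (pow_apply_mem hW _ hu)),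
      fun c => ?_⟩
    simp only [map_sub, map_sum, map_smul, smul_eq_mul, bilin_pow_pow_apply hsa, hgram]
    by_cases hc : c ≤ n
    · rw [Finset.sum_eq_single (⟨n - c, by omega⟩ : Fin (n + 1))]
      · simp [Nat.sub_sub_self hc, Nat.add_sub_of_le hc]
      · intro b _ hb
        rw [if_neg fun h => hb (Fin.ext (by simp only; omega)), mul_zero]
      · simp
    · rw [pow_apply_eq_zero_of_le (hz u hu) (by omega), Finset.sum_eq_zero]
      · simp
      · intro b _
        rw [if_neg (by omega), mul_zero]
  have hnd' : ∀ v ∈ W', (∀ w ∈ W', B v w = 0) → v = 0 := fun v hv h => by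
    refine hnd v (hle hv) fun w hw => ?_
    have := h _ (hproj w hw)
    simpa [hsymm v ((x ^ _) u), ((hmem v).mp hv).2] using this
  obtain ⟨s, lam, v, hanti, hone, hvW, hzero, hB, hspan⟩ :=
    ih _ (Submodule.finrank_lt_finrank_of_lt hlt) W' hW' hnd' rfl
  have hlam : ∀ i, lam i ≤ n + 1 := fun i => by
    by_contra! hi
    have := hB i i (lam i - 1)
    rw [pow_apply_eq_zero_of_le (hz _ (hle (hvW i))) (by omega),
      if_pos ⟨rfl, Nat.sub_add_cancel (hone i)⟩] at this
    simp at this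
  refine ⟨s + 1, Fin.cons (n + 1) lam, Fin.cons u v, ?_, ?_, ?_, ?_, ?_, ?_⟩
  · intro i j hij
    induction i using Fin.cases with
    | zero => induction j using Fin.cases with
      | zero => exact le_rfl
      | succ j => simpa using hlam j
    | succ i => induction j using Fin.cases with
      | zero => simp at hij
      | succ j => simpa using hanti (Fin.succ_le_succ_iff.mp hij)
  · exact Fin.cases (by simp) (by simpa using hone)
  · exact Fin.cases (by simpa using hu) (fun i => by simpa using hle (hvW i))
  · exact Fin.cases (by simpa using hz u hu) (by simpa using hzero)
  · intro i j a
    induction i using Fin.cases with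
    | zero => induction j using Fin.cases with
      | zero => simpa using hgram a
      | succ j => simpa [(Fin.succ_ne_zero j).symm] using ((hmem _).mp (hvW j)).2 a
    | succ i => induction j using Fin.cases with
      | zero =>
        simpa [bilin_pow_apply_comm hsa, hsymm (v i)] using ((hmem _).mp (hvW i)).2 a
      | succ j => simpa using hB i j a
  · intro w hw
    rw [← sub_add_cancel w (∑ a : Fin (n + 1), B ((x ^ (n - a)) u) w • (x ^ (a : ℕ)) u)]
    refine Submodule.add_mem _ ?_ (Submodule.sum_mem _ fun a _ => Submodule.smul_mem _ _ ?_)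
    · refine Submodule.span_mono ?_ (hspan (hproj w hw))
      rintro _ ⟨⟨i, a⟩, rfl⟩
      exact ⟨⟨i.succ, a⟩, rfl⟩
    · exact Submodule.subset_span ⟨⟨0, a⟩, rfl⟩

lemma linearIndependent_of_bilin_pow_apply (hsa : ∀ u v, B (x u) v = B u (x v))
    {s : ℕ} {lam : Fin s → ℕ} {v : Fin s → V}
    (hB : ∀ i j a, B ((x ^ a) (v i)) (v j) = if i = j ∧ a + 1 = lam i then 1 else 0) :
    LinearIndependent K
      (fun p : (i : Fin s) × Fin (lam i) => (x ^ (p.2 : ℕ)) (v p.1)) := by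
  rw [Fintype.linearIndependent_iff]
  rintro g hg ⟨i, a⟩
  have key := congrArg (fun w => B w ((x ^ (lam i - 1 - a)) (v i))) hg
  simp only [map_sum, map_smul, LinearMap.sum_apply, LinearMap.smul_apply, smul_eq_mul,
    bilin_pow_pow_apply hsa, hB, map_zero, LinearMap.zero_apply] at key
  rw [Finset.sum_eq_single ⟨i, a⟩] at key
  · rwa [if_pos ⟨rfl, by have := a.is_lt; dsimp only; omega⟩, mul_one] at key
  · rintro ⟨j, c⟩ _ hne
    rw [if_neg, mul_zero]
    rintro ⟨h, hc⟩
    dsimp only at h hc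
    subst h
    have := a.2
    exact hne (congrArg (Sigma.mk j) (Fin.ext (by omega)))
  · simp

end SelfAdjointNilpotent

/-- Normal form (Lemma 2.2 of the paper): for a nilpotent self-adjoint
endomorphism `x` of a finite-dimensional complex vector space `V` with a nondegenerate
symmetric bilinear form `B`, there is a partition `λ₁ ≥ ⋯ ≥ λ_s ≥ 1` of `N = dim V` and
vectors `v₁, …, v_s` such that `x^{λ i} v i = 0`, the vectors `x^a v i` (`0 ≤ a < λ i`)
form a basis of `V`, and `B (x^a v i) (x^b v j) = δ_{i j} δ_{a+b, λ i − 1}`. -/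
theorem stmt_0 {V : Type*} [AddCommGroup V] [Module ℂ V] [FiniteDimensional ℂ V]
    (N : ℕ) (hN : 1 ≤ N) (hdim : finrank ℂ V = N)
    (B : V →ₗ[ℂ] V →ₗ[ℂ] ℂ)
    (hsymm : ∀ u v : V, B u v = B v u)
    (hnd : ∀ v : V, (∀ w : V, B v w = 0) → v = 0)
    (x : Module.End ℂ V)
    (hsa : ∀ u v : V, B (x u) v = B u (x v))
    (hnil : IsNilpotent x) :
    ∃ s : ℕ, 1 ≤ s ∧
      ∃ lam : Fin s → ℕ, Antitone lam ∧ (∀ i, 1 ≤ lam i) ∧ (∑ i, lam i = N) ∧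
        ∃ v : Fin s → V,
          (∀ i, (x ^ lam i) (v i) = 0) ∧
          (∃ b : Basis ((i : Fin s) × Fin (lam i)) ℂ V,
            ∀ p : (i : Fin s) × Fin (lam i), b p = (x ^ (p.2 : ℕ)) (v p.1)) ∧
          (∀ (i j : Fin s) (a : Fin (lam i)) (c : Fin (lam j)),
            B ((x ^ (a : ℕ)) (v i)) ((x ^ (c : ℕ)) (v j)) =
              if i = j ∧ (a : ℕ) + (c : ℕ) = lam i - 1 then 1 else 0) := by
  obtain ⟨s, lam, v, hanti, hone, -, hzero, hB, hspan⟩ :=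
    exists_orthogonal_cyclic_generators hsymm hsa hnil ⊤ (fun _ _ => Submodule.mem_top)
      (fun v _ h => hnd v fun w => h w Submodule.mem_top)
  let b := Basis.mk (linearIndependent_of_bilin_pow_apply hsa hB) hspan
  have hsum : ∑ i, lam i = N := by
    rw [← hdim, finrank_eq_card_basis b]
    simp
  refine ⟨s, ?_, lam, hanti, hone, hsum, v, hzero, ⟨b, fun p => by simp [b]⟩,
    fun i j a c => ?_⟩
  · rcases Nat.eq_zero_or_pos s with rfl | hs
    · simp at hsum
      omega
    · exact hs
  · rw [bilin_pow_pow_apply hsa, hB]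
    have := hone i
    exact if_congr (and_congr_right fun _ => by omega) rfl rfl
end

section
/- Let V be a complex vector space of dimension N with a nondegenerate symmetric bilinear form B, and let x : V → V be a nilpotent B-self-adjoint endomorphism whose Jordan type is the partition λ = (λ₁ ≥ … ≥ λ_s ≥ 1) of N, in the sense that dim ker(x^k) = Σ_{i=1}^s min(λ_i, k) for every k ≥ 0. Then the space of B-skew-adjoint endomorphisms of V commuting with x, i.e. {y ∈ End(V) : B(y u, v) = −B(u, y v) for all u, v, and y ∘ x = x ∘ y}, has complex dimension Σ_{i=1}^{s} (i − 1) λ_i. -/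
open Module

/-- The space of endomorphisms of `V` that are skew-adjoint with respect to the bilinear
form `B` and commute with `x`. -/
def skewCentralizer {V : Type*} [AddCommGroup V] [Module ℂ V]
    (B : V →ₗ[ℂ] V →ₗ[ℂ] ℂ) (x : Module.End ℂ V) : Submodule ℂ (Module.End ℂ V) where
  carrier := {y | (∀ u v : V, B (y u) v = - B u (y v)) ∧ y * x = x * y}
  zero_mem' := by
    refine ⟨fun u v => ?_, by simp⟩
    simp
  add_mem' := by
    rintro a b ⟨ha1, ha2⟩ ⟨hb1, hb2⟩
    refine ⟨fun u v => ?_, by rw [add_mul, mul_add, ha2, hb2]⟩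
    simp only [LinearMap.add_apply, map_add]
    rw [ha1 u v, hb1 u v]
    ring
  smul_mem' := by
    rintro c a ⟨ha1, ha2⟩
    refine ⟨fun u v => ?_, by rw [smul_mul_assoc, mul_smul_comm, ha2]⟩
    simp only [LinearMap.smul_apply, map_smul, smul_eq_mul]
    rw [ha1 u v]
    ring

/-- The skew-symmetric bilinear forms on `V` for which `x` is self-adjoint. -/
def skewForms {K V : Type*} [Field K] [AddCommGroup V] [Module K V]
    (x : Module.End K V) : Submodule K (V →ₗ[K] V →ₗ[K] K) where
  carrier := {C | (∀ u v, C u v = - C v u) ∧ ∀ u v, C (x u) v = C u (x v)}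
  zero_mem' := by simp
  add_mem' := by
    rintro a b ⟨ha1, ha2⟩ ⟨hb1, hb2⟩
    refine ⟨fun u v => ?_, fun u v => ?_⟩
    · simp only [LinearMap.add_apply]
      rw [ha1 u v, hb1 u v]
      ring
    · simp only [LinearMap.add_apply, ha2, hb2]
  smul_mem' := by
    rintro c a ⟨ha1, ha2⟩
    refine ⟨fun u v => ?_, fun u v => ?_⟩
    · simp only [LinearMap.smul_apply, smul_eq_mul]
      rw [ha1 u v]
      ring
    · simp only [LinearMap.smul_apply, ha2]

/-- A nondegenerate symmetric form for which `x` is self-adjoint identifies the skew-adjoint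
endomorphisms commuting with `x` with the skew forms for which `x` is self-adjoint. -/
theorem finrank_skewCentralizer_eq_finrank_skewForms {V : Type*} [AddCommGroup V] [Module ℂ V]
    [FiniteDimensional ℂ V] (B : V →ₗ[ℂ] V →ₗ[ℂ] ℂ) (hsymm : ∀ u v : V, B u v = B v u)
    (hnd : ∀ v : V, (∀ w : V, B v w = 0) → v = 0) (x : Module.End ℂ V)
    (hsa : ∀ u v : V, B (x u) v = B u (x v)) :
    finrank ℂ (skewCentralizer B x) = finrank ℂ (skewForms x) := by
  have hinj : Function.Injective B :=
    (injective_iff_map_eq_zero B).2 fun v hv => hnd v fun w => by simp [hv]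
  let e : V ≃ₗ[ℂ] Dual ℂ V :=
    LinearEquiv.ofInjectiveOfFinrankEq B hinj Subspace.dual_finrank_eq.symm
  have he : ∀ v, e v = B v := fun v => rfl
  let E : Module.End ℂ V ≃ₗ[ℂ] (V →ₗ[ℂ] V →ₗ[ℂ] ℂ) := e.congrRight
  have hE : ∀ y u, E y u = B (y u) := fun y u => rfl
  have hcomap : skewCentralizer B x = (skewForms x).comap E.toLinearMap := by
    ext y
    change ((∀ u v : V, B (y u) v = - B u (y v)) ∧ y * x = x * y) ↔
      ((∀ u v, E y u v = - E y v u) ∧ ∀ u v, E y (x u) v = E y u (x v))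
    simp only [hE]
    refine and_congr ?_ ?_
    · simp only [fun u v => hsymm u (y v)]
    · refine ⟨fun h u v => ?_, fun h => LinearMap.ext fun u => hinj (LinearMap.ext fun v => ?_)⟩
      · rw [← hsa, ← Module.End.mul_apply, h, Module.End.mul_apply]
      · simp only [Module.End.mul_apply, h, hsa]
  rw [hcomap, Submodule.comap_equiv_eq_map_symm]
  exact LinearEquiv.finrank_map_eq _ _

theorem finrank_skewForms_zero {K V : Type*} [Field K] [NeZero (2 : K)] [AddCommGroup V]
    [Module K V] [FiniteDimensional K V] :
    finrank K (skewForms (0 : Module.End K V)) = ∑ i : Fin (finrank K V), (i : ℕ) := by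
  let b := finBasis K V
  let f : skewForms (0 : Module.End K V) →ₗ[K] ((j : Fin (finrank K V)) × Fin (j : ℕ) → K) :=
    { toFun := fun C p => C.1 (b (Fin.castLE p.1.2.le p.2)) (b p.1)
      map_add' := fun C D => rfl
      map_smul' := fun c C => rfl }
  have hf : ∀ (C : skewForms (0 : Module.End K V)) (i j : Fin (finrank K V)) (h : i < j),
      C.1 (b i) (b j) = f C ⟨j, ⟨i, h⟩⟩ := fun C i j h => rfl
  have hinj : Function.Injective f := by
    intro C D hCD
    have hlt : ∀ i j, i < j → C.1 (b i) (b j) = D.1 (b i) (b j) := fun i j h => by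
      rw [hf C i j h, hf D i j h, hCD]
    have hdiag : ∀ (C : skewForms (0 : Module.End K V)) v, C.1 v v = 0 := fun C v => by
      have h2 : (2 : K) * C.1 v v = 0 := by linear_combination C.2.1 v v
      exact (mul_eq_zero.1 h2).resolve_left two_ne_zero
    refine Subtype.ext (LinearMap.ext_basis b b fun i j => ?_)
    rcases lt_trichotomy i j with h | rfl | h
    · exact hlt i j h
    · rw [hdiag, hdiag]
    · rw [C.2.1, D.2.1, hlt j i h]
  have hsurj : Function.Surjective f := by
    intro g
    let M : Matrix (Fin (finrank K V)) (Fin (finrank K V)) K := fun i j =>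
      if h : i < j then g ⟨j, ⟨i, h⟩⟩ else if h : j < i then - g ⟨i, ⟨j, h⟩⟩ else 0
    have hM : ∀ i j, M i j = - M j i := by
      intro i j
      rcases lt_trichotomy i j with h | rfl | h
      · simp [M, h, h.not_gt]
      · simp [M]
      · simp [M, h, h.not_gt]
    let C := Matrix.toLinearMap₂ b b M
    have hC : ∀ i j, C (b i) (b j) = M i j := fun i j => by
      rw [← LinearMap.toMatrix₂_apply b b C, LinearMap.toMatrix₂_toLinearMap₂]
    have hskew : C = -C.flip := LinearMap.ext_basis b b fun i j => by simp [hC, hM i j]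
    refine ⟨⟨C, fun u v => ?_, by simp⟩, ?_⟩
    · exact congrArg (fun D : V →ₗ[K] V →ₗ[K] K => D u v) hskew
    · ext ⟨j, i, h⟩
      have h' : Fin.castLE j.2.le ⟨i, h⟩ < j := h
      change C (b (Fin.castLE j.2.le ⟨i, h⟩)) (b j) = _
      rw [hC]
      simp only [M, dif_pos h']
      rfl
  rw [(LinearEquiv.ofBijective f ⟨hinj, hsurj⟩).finrank_eq, finrank_fintype_fun_eq_card,
    Fintype.card_sigma]
  simp

/-- The restriction of `x` to its own range. -/
def LinearMap.restrictRange {K V : Type*} [Field K] [AddCommGroup V] [Module K V]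
    (x : Module.End K V) : Module.End K (LinearMap.range x) :=
  x.restrict fun v _ => LinearMap.mem_range_self x v

theorem LinearMap.finrank_range_restrictRange_pow {K V : Type*} [Field K] [AddCommGroup V]
    [Module K V] (x : Module.End K V) (k : ℕ) :
    finrank K (LinearMap.range (x.restrictRange ^ k)) =
      finrank K (LinearMap.range (x ^ (k + 1))) := by
  have hpow : ∀ w : LinearMap.range x, ((x.restrictRange ^ k) w : V) = (x ^ k) w := by
    intro w
    rw [LinearMap.restrictRange, Module.End.pow_restrict]
    rfl
  have hmap : (LinearMap.range (x.restrictRange ^ k)).map (LinearMap.range x).subtype =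
      LinearMap.range (x ^ (k + 1)) := by
    ext v
    constructor
    · rintro ⟨_, ⟨⟨_, u, rfl⟩, rfl⟩, rfl⟩
      exact ⟨u, by simp [hpow, pow_succ]⟩
    · rintro ⟨u, rfl⟩
      exact ⟨_, ⟨⟨x u, u, rfl⟩, rfl⟩, by simp [hpow, pow_succ]⟩
  rw [← hmap, Submodule.finrank_map_subtype_eq]

set_option maxSynthPendingDepth 3 in
/-- Skew forms for which `x` is self-adjoint are an extension of those on the range of `x` by the
skew forms on the cokernel of `x`. -/
theorem finrank_skewForms_eq_add {K V : Type*} [Field K] [NeZero (2 : K)] [AddCommGroup V]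
    [Module K V] [FiniteDimensional K V] (x : Module.End K V) :
    finrank K (skewForms x) = finrank K (skewForms x.restrictRange) +
      finrank K (skewForms (0 : Module.End K (V ⧸ LinearMap.range x))) := by
  obtain ⟨τ, hτ⟩ := x.rangeRestrict.exists_rightInverse_of_surjective x.range_rangeRestrict
  obtain ⟨σ, hσ⟩ := (LinearMap.range x).mkQ.exists_rightInverse_of_surjective
    (LinearMap.range x).range_mkQ
  have hxτ : ∀ w : LinearMap.range x, x (τ w) = w := fun w =>
    congrArg Subtype.val (LinearMap.congr_fun hτ w)
  have hπσ : ∀ q, (LinearMap.range x).mkQ (σ q) = q := fun q => LinearMap.congr_fun hσ q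
  have hπx : ∀ u, (LinearMap.range x).mkQ (x u) = 0 := fun u => by simp
  let p : V →ₗ[K] LinearMap.range x :=
    (LinearMap.id - σ ∘ₗ (LinearMap.range x).mkQ).codRestrict _ fun v => by
      refine (LinearMap.range x).ker_mkQ.le ?_
      rw [LinearMap.mem_ker]
      simp only [LinearMap.sub_apply, map_sub, LinearMap.comp_apply, hπσ, LinearMap.id_apply,
        sub_self]
  have hp : ∀ v, (p v : V) = v - σ ((LinearMap.range x).mkQ v) := fun v => rfl
  have hpx : ∀ w : LinearMap.range x, p w = w := by
    rintro ⟨_, u, rfl⟩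
    exact Subtype.ext (by rw [hp, hπx, map_zero, sub_zero])
  have hC : ∀ C ∈ skewForms x, ∀ (w : LinearMap.range x) (v : V),
      C w (τ (x.rangeRestrict v)) = C w v := by
    rintro C hC ⟨_, u, rfl⟩ v
    simp only [hC.2, hxτ]
    rfl
  let T : skewForms x →ₗ[K] skewForms x.restrictRange :=
    { toFun := fun C => ⟨C.1.compl₁₂ (LinearMap.range x).subtype τ, by
        refine ⟨?_, ?_⟩
        · rintro ⟨_, u, rfl⟩ ⟨_, v, rfl⟩
          change C.1 (x u) (τ (x.rangeRestrict v)) = - C.1 (x v) (τ (x.rangeRestrict u))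
          rw [hC C.1 C.2 ⟨x u, u, rfl⟩, hC C.1 C.2 ⟨x v, v, rfl⟩, C.2.2, C.2.1]
        · rintro w ⟨_, v, rfl⟩
          change C.1 (x w) (τ (x.rangeRestrict v)) = C.1 w (τ (x.rangeRestrict (x v)))
          rw [hC C.1 C.2 ⟨x w, w, rfl⟩, hC C.1 C.2, C.2.2]⟩
      map_add' := fun C D => rfl
      map_smul' := fun c C => rfl }
  have hT : ∀ C w w', (T C).1 w w' = C.1 w (τ w') := fun C w w' => rfl
  have hsurj : Function.Surjective T := by
    intro D
    let F : V →ₗ[K] V →ₗ[K] K := D.1.compl₁₂ p x.rangeRestrict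
    have hF : ∀ u v, F u v = D.1 (p u) (x.rangeRestrict v) := fun u v => rfl
    let G : V →ₗ[K] V →ₗ[K] K :=
      D.1.compl₁₂ p (x.rangeRestrict ∘ₗ (LinearMap.range x).subtype ∘ₗ p)
    have hG : ∀ u v, G u v = D.1 (p u) (x.restrictRange (p v)) := fun u v => rfl
    let C : V →ₗ[K] V →ₗ[K] K := F - F.flip - G
    have hCapp : ∀ u v, C u v = F u v - F v u - G u v := fun u v => rfl
    have hGskew : ∀ u v, G u v = - G v u := fun u v => by
      rw [hG, hG, D.2.1, D.2.2]
    have hskew : ∀ u v, C u v = - C v u := fun u v => by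
      rw [hCapp, hCapp, hGskew u v]
      ring
    have hCx : ∀ (w : LinearMap.range x) v, C w v = D.1 w (x.rangeRestrict v) := fun w v => by
      have h1 : x.rangeRestrict (w : V) = x.restrictRange w := rfl
      rw [hCapp, hF, hF, hG, hpx, h1, ← D.2.2 w (p v), D.2.1 (x.restrictRange w) (p v)]
      ring
    have hself : ∀ u v, C (x u) v = C u (x v) := fun u v => by
      rw [hskew u, hCx ⟨x u, u, rfl⟩, hCx ⟨x v, v, rfl⟩, D.2.1]
      rfl
    refine ⟨⟨C, hskew, hself⟩, Subtype.ext (LinearMap.ext₂ fun w w' => ?_)⟩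
    rw [hT]
    change C w (τ w') = _
    rw [hCx]
    exact congrArg _ (LinearMap.congr_fun hτ w')
  have hker : ∀ C : skewForms x, C ∈ LinearMap.ker T ↔ ∀ u v, C.1 (x u) v = 0 := by
    intro C
    rw [LinearMap.mem_ker]
    refine ⟨fun h u v => ?_, fun h => Subtype.ext (LinearMap.ext₂ ?_)⟩
    · rw [← hC C.1 C.2 ⟨x u, u, rfl⟩ v, ← hT, h]
      rfl
    · rintro ⟨_, u, rfl⟩ w'
      exact h u _
  have hC0 : ∀ C ∈ LinearMap.ker T, ∀ u v,
      C.1 (σ ((LinearMap.range x).mkQ u)) (σ ((LinearMap.range x).mkQ v)) = C.1 u v := by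
    intro C hmem u v
    have hl : ∀ (w : LinearMap.range x) v, C.1 w v = 0 := by
      rintro ⟨_, u, rfl⟩ v
      exact (hker C).1 hmem u v
    have hd : ∀ u, σ ((LinearMap.range x).mkQ u) = u - p u := fun u => by rw [hp]; abel
    have hr : ∀ (w : LinearMap.range x) v, C.1 v w = 0 := fun w v => by
      rw [C.2.1, hl, neg_zero]
    simp only [hd, map_sub, LinearMap.sub_apply, hr, hl, sub_zero]
  let E : LinearMap.ker T ≃ₗ[K] skewForms (0 : Module.End K (V ⧸ LinearMap.range x)) :=
    { toFun := fun C => ⟨C.1.1.compl₁₂ σ σ, fun u v => C.1.2.1 _ _, by simp⟩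
      map_add' := fun C D => rfl
      map_smul' := fun c C => rfl
      invFun := fun D => ⟨⟨D.1.compl₁₂ (LinearMap.range x).mkQ (LinearMap.range x).mkQ,
        fun u v => D.2.1 _ _, fun u v => by simp only [LinearMap.compl₁₂_apply, hπx, map_zero,
          LinearMap.zero_apply]⟩,
        (hker _).2 fun u v => by simp only [LinearMap.compl₁₂_apply, hπx, map_zero,
          LinearMap.zero_apply]⟩
      left_inv := fun C => Subtype.ext (Subtype.ext (LinearMap.ext₂ fun u v => hC0 C.1 C.2 u v))
      right_inv := fun D => Subtype.ext (LinearMap.ext₂ fun u v => by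
        simp only [LinearMap.compl₁₂_apply, hπσ]) }
  rw [← T.finrank_range_add_finrank_ker, LinearMap.range_eq_top.2 hsurj, finrank_top,
    E.finrank_eq]

theorem Antitone.sum_mul_min_one {s : ℕ} {lam : Fin s → ℕ} (hanti : Antitone lam) :
    ∑ i : Fin s, (i : ℕ) * min (lam i) 1 = ∑ j : Fin (∑ i, min (lam i) 1), (j : ℕ) := by
  rw [Fin.sum_univ_eq_sum_range (fun i => i)]
  induction s with
  | zero => simp
  | succ s ih =>
    rcases Nat.eq_zero_or_pos (lam (Fin.last s)) with h | h
    · have := ih (lam := fun i => lam i.castSucc) fun i j hij => hanti (by simpa using hij)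
      simpa [Fin.sum_univ_castSucc, h] using this
    · have h1 : ∀ i, min (lam i) 1 = 1 := fun i =>
        min_eq_right (h.trans_le (hanti (Fin.le_last i)))
      simp [h1, Fin.sum_univ_eq_sum_range (fun i => i)]

theorem finrank_skewForms {K V : Type*} [Field K] [NeZero (2 : K)] [AddCommGroup V]
    [Module K V] [FiniteDimensional K V] (x : Module.End K V) {s : ℕ} {lam : Fin s → ℕ}
    (hanti : Antitone lam)
    (hrange : ∀ k : ℕ, finrank K (LinearMap.range (x ^ k)) = ∑ i, (lam i - k)) :
    finrank K (skewForms x) = ∑ i : Fin s, (i : ℕ) * lam i := by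
  induction hn : finrank K V using Nat.strong_induction_on generalizing V lam with
  | _ n ih =>
  have h0 : finrank K V = ∑ i, lam i := by
    have := hrange 0
    rwa [pow_zero, Module.End.one_eq_id, LinearMap.range_id, finrank_top] at this
  have h1 : finrank K (LinearMap.range x) = ∑ i, (lam i - 1) := by rw [← hrange 1, pow_one]
  have hsplit : ∀ i, lam i = (lam i - 1) + min (lam i) 1 := fun i => by omega
  have hcoker : finrank K (V ⧸ LinearMap.range x) = ∑ i, min (lam i) 1 := by
    have h2 := (LinearMap.range x).finrank_quotient_add_finrank
    have h3 : ∑ i, lam i = ∑ i, (lam i - 1) + ∑ i, min (lam i) 1 := by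
      rw [← Finset.sum_add_distrib]
      exact Finset.sum_congr rfl fun i _ => hsplit i
    omega
  have hmain : finrank K (skewForms x.restrictRange) = ∑ i : Fin s, (i : ℕ) * (lam i - 1) := by
    rcases Nat.eq_zero_or_pos n with h | h
    · have hlam : ∀ i, lam i = 0 := by
        rw [hn, h, eq_comm, Finset.sum_eq_zero_iff] at h0
        simpa using h0
      have : Subsingleton V := finrank_zero_iff.1 (hn.trans h)
      have : Subsingleton (LinearMap.range x →ₗ[K] LinearMap.range x →ₗ[K] K) :=
        ⟨fun C D => LinearMap.ext fun u => by simp [Subsingleton.elim u 0]⟩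
      simp [hlam, finrank_zero_of_subsingleton]
    · refine ih (finrank K (LinearMap.range x)) ?_ x.restrictRange
        (fun i j hij => Nat.sub_le_sub_right (hanti hij) 1) (fun k => ?_) rfl
      · rw [h1, ← hn, h0]
        obtain ⟨i, -, hi⟩ := Finset.exists_ne_zero_of_sum_ne_zero (h0 ▸ hn ▸ h.ne')
        exact Finset.sum_lt_sum (fun i _ => Nat.sub_le _ _) ⟨i, Finset.mem_univ i, by omega⟩
      · rw [LinearMap.finrank_range_restrictRange_pow, hrange]
        exact Finset.sum_congr rfl fun i _ => by omega
  rw [finrank_skewForms_eq_add, hmain, finrank_skewForms_zero, hcoker, ← hanti.sum_mul_min_one,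
    ← Finset.sum_add_distrib]
  refine Finset.sum_congr rfl fun i _ => ?_
  rw [← mul_add, ← hsplit]

/-- If `x` is a nilpotent `B`-self-adjoint endomorphism of Jordan type
`λ₁ ≥ ⋯ ≥ λ_s ≥ 1` (i.e. `dim ker x^k = ∑ min(λ_i, k)`), then the space of
`B`-skew-adjoint endomorphisms commuting with `x` has dimension `∑ (i−1) λ_i`
(here indexed from `0`, so the coefficient of `lam i` is `i`). -/
theorem stmt_1 {V : Type*} [AddCommGroup V] [Module ℂ V] [FiniteDimensional ℂ V]
    (N : ℕ) (hdim : finrank ℂ V = N)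
    (B : V →ₗ[ℂ] V →ₗ[ℂ] ℂ)
    (hsymm : ∀ u v : V, B u v = B v u)
    (hnd : ∀ v : V, (∀ w : V, B v w = 0) → v = 0)
    (x : Module.End ℂ V)
    (hsa : ∀ u v : V, B (x u) v = B u (x v))
    (hnil : IsNilpotent x)
    (s : ℕ) (lam : Fin s → ℕ) (hanti : Antitone lam) (hpos : ∀ i, 1 ≤ lam i)
    (hsum : ∑ i, lam i = N)
    (hJordan : ∀ k : ℕ, finrank ℂ (LinearMap.ker (x ^ k)) = ∑ i, min (lam i) k) :
    finrank ℂ (skewCentralizer B x) = ∑ i : Fin s, (i : ℕ) * lam i := by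
  rw [finrank_skewCentralizer_eq_finrank_skewForms B hsymm hnd x hsa]
  refine finrank_skewForms x hanti fun k => ?_
  have h := LinearMap.finrank_range_add_finrank_ker (x ^ k)
  have hsplit : ∑ i, lam i = ∑ i, (lam i - k) + ∑ i, min (lam i) k := by
    rw [← Finset.sum_add_distrib]
    exact Finset.sum_congr rfl fun i _ => by omega
  rw [hJordan, hdim, ← hsum] at h
  omega
end

section
/- Let V be a complex vector space of finite dimension with a nondegenerate symmetric bilinear form B, and let x : V → V be a B-self-adjoint endomorphism with x ∘ x = 0 and rank x = j. Then the image of x is contained in the kernel of x, the B-orthogonal complement of Im x equals ker x, and B induces a nondegenerate symmetric bilinear form B̄ on the quotient ker x / Im x. Moreover, for every integer i ≥ j, every B-isotropic subspace U of V with dim U = i and Im x ⊆ U satisfies U ⊆ ker x, and the map U ↦ U / Im x is a bijection from the set of B-isotropic subspaces U with dim U = i and Im x ⊆ U onto the set of B̄-isotropic subspaces of ker x / Im x of dimension i − j. -/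
open Module

/-- A symmetric bilinear form vanishing on `P` descends to the quotient by `P`. -/
lemma exists_bilinear_quotient {K M : Type*} [Field K] [AddCommGroup M] [Module K M]
    (B : M →ₗ[K] M →ₗ[K] K) (hsymm : ∀ u v, B u v = B v u) (P : Submodule K M)
    (hP : ∀ p ∈ P, ∀ v, B p v = 0) :
    ∃ C : (M ⧸ P) →ₗ[K] (M ⧸ P) →ₗ[K] K,
      ∀ u v : M, C (Submodule.Quotient.mk u) (Submodule.Quotient.mk v) = B u v := by
  have h₁ : P ≤ LinearMap.ker B := fun p hp => LinearMap.ext (hP p hp)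
  have h₂ : P ≤ LinearMap.ker (P.liftQ B h₁).flip := by
    intro p hp
    ext v
    simpa using (hsymm v p).trans (hP p hp v)
  refine ⟨(P.liftQ (P.liftQ B h₁).flip h₂).flip, fun u v => ?_⟩
  rfl

lemma finrank_map_mkQ_add_finrank {K M : Type*} [Field K] [AddCommGroup M] [Module K M]
    [FiniteDimensional K M] {P Y : Submodule K M} (h : P ≤ Y) :
    finrank K (Y.map P.mkQ) + finrank K P = finrank K Y := by
  have := (P.mkQ.domRestrict Y).finrank_range_add_finrank_ker
  rwa [LinearMap.range_domRestrict, LinearMap.ker_domRestrict, Submodule.ker_mkQ,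
    (Submodule.comapSubtypeEquivOfLe h).finrank_eq] at this

/-- For a nondegenerate symmetric form, a vector orthogonal to the orthogonal complement of `W`
lies in `W`. -/
lemma mem_of_orthogonal_orthogonal {K V : Type*} [Field K] [AddCommGroup V] [Module K V]
    [FiniteDimensional K V] (B : V →ₗ[K] V →ₗ[K] K) (hsymm : ∀ u v, B u v = B v u)
    (hnd : ∀ v, (∀ w, B v w = 0) → v = 0) (W : Submodule K V) {u : V}
    (hu : ∀ w, (∀ y ∈ W, B y w = 0) → B u w = 0) : u ∈ W := by
  have hB : LinearMap.BilinForm.Nondegenerate B :=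
    ⟨hnd, fun v hv => hnd v fun w => (hsymm v w).trans (hv w)⟩
  have hrefl : LinearMap.BilinForm.IsRefl B := fun u v h => (hsymm v u).trans h
  rw [← LinearMap.BilinForm.orthogonal_orthogonal hB hrefl W]
  exact fun w hw => (hsymm w u).trans (hu w hw)

/-- Let `B` be a nondegenerate symmetric bilinear form on a
finite-dimensional complex vector space `V` and `x` a `B`-self-adjoint endomorphism with
`x² = 0` and `rank x = j`.  Then `Im x ⊆ ker x`, the `B`-orthogonal of `Im x` is `ker x`,
`B` induces a nondegenerate symmetric bilinear form `B̄` on `ker x / Im x`, and for each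
`i ≥ j`: every `B`-isotropic `i`-dimensional subspace containing `Im x` lies in `ker x`,
and `U ↦ U / Im x` is a bijection from the set of such subspaces onto the set of
`(i−j)`-dimensional `B̄`-isotropic subspaces of `ker x / Im x`. -/
theorem stmt_3 {V : Type*} [AddCommGroup V] [Module ℂ V] [FiniteDimensional ℂ V]
    (B : V →ₗ[ℂ] V →ₗ[ℂ] ℂ)
    (hsymm : ∀ u v : V, B u v = B v u)
    (hnd : ∀ v : V, (∀ w : V, B v w = 0) → v = 0)
    (x : Module.End ℂ V)
    (hsa : ∀ u v : V, B (x u) v = B u (x v))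
    (hx2 : x * x = 0)
    (j : ℕ) (hrk : finrank ℂ (LinearMap.range x) = j) :
    LinearMap.range x ≤ LinearMap.ker x ∧
    (∀ v : V, (∀ u : V, B (x u) v = 0) ↔ v ∈ LinearMap.ker x) ∧
    ∃ Bbar :
        (↥(LinearMap.ker x) ⧸ Submodule.comap (LinearMap.ker x).subtype (LinearMap.range x)) →ₗ[ℂ]
        (↥(LinearMap.ker x) ⧸ Submodule.comap (LinearMap.ker x).subtype (LinearMap.range x)) →ₗ[ℂ] ℂ,
      (∀ u v : LinearMap.ker x,
        Bbar (Submodule.Quotient.mk u) (Submodule.Quotient.mk v) = B (u : V) (v : V)) ∧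
      (∀ q r, Bbar q r = Bbar r q) ∧
      (∀ q, (∀ r, Bbar q r = 0) → q = 0) ∧
      ∀ i : ℕ, j ≤ i →
        (∀ U : Submodule ℂ V,
          (∀ u ∈ U, ∀ u' ∈ U, B u u' = 0) → finrank ℂ U = i → LinearMap.range x ≤ U →
            U ≤ LinearMap.ker x) ∧
        Set.BijOn
          (fun U : Submodule ℂ V =>
            Submodule.map
              (Submodule.comap (LinearMap.ker x).subtype (LinearMap.range x)).mkQ
              (Submodule.comap (LinearMap.ker x).subtype U))
          {U : Submodule ℂ V |
            (∀ u ∈ U, ∀ u' ∈ U, B u u' = 0) ∧ finrank ℂ U = i ∧ LinearMap.range x ≤ U}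
          {W : Submodule ℂ
              (↥(LinearMap.ker x) ⧸
                Submodule.comap (LinearMap.ker x).subtype (LinearMap.range x)) |
            (∀ q ∈ W, ∀ r ∈ W, Bbar q r = 0) ∧ finrank ℂ W = i - j} := by
  have hxx : ∀ u, x (x u) = 0 := fun u => LinearMap.congr_fun hx2 u
  have hle : LinearMap.range x ≤ LinearMap.ker x := by
    rintro _ ⟨u, rfl⟩
    exact hxx u
  have horth : ∀ v : V, (∀ u : V, B (x u) v = 0) ↔ v ∈ LinearMap.ker x := by
    intro v
    refine ⟨fun h => hnd _ fun w => ?_, fun h u => ?_⟩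
    · rw [hsymm, ← hsa]
      exact h w
    · rw [hsa, LinearMap.mem_ker.mp h, map_zero]
  obtain ⟨Bbar, hBbar⟩ := exists_bilinear_quotient
    (B.domRestrict₁₂ (LinearMap.ker x) (LinearMap.ker x)) (fun u v => hsymm u v)
    (Submodule.comap (LinearMap.ker x).subtype (LinearMap.range x)) (by
      rintro p ⟨u, hu⟩ v
      change B ((LinearMap.ker x).subtype p) v = 0
      rw [← hu]
      exact (horth v).mpr v.2 u)
  have hBbar' : ∀ u v : LinearMap.ker x,
      Bbar (Submodule.Quotient.mk u) (Submodule.Quotient.mk v) = B (u : V) (v : V) := hBbar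
  refine ⟨hle, horth, Bbar, hBbar', ?_, ?_, ?_⟩
  · rintro ⟨u⟩ ⟨v⟩
    exact (hBbar' u v).trans ((hsymm _ _).trans (hBbar' v u).symm)
  · rintro ⟨u⟩ h
    refine (Submodule.Quotient.mk_eq_zero _).mpr ?_
    refine mem_of_orthogonal_orthogonal B hsymm hnd (LinearMap.range x) fun w hw => ?_
    have hwk : w ∈ LinearMap.ker x := (horth w).mp fun y => hw _ ⟨y, rfl⟩
    exact (hBbar' u ⟨w, hwk⟩).symm.trans (h _)
  intro i hi
  have hker : ∀ U : Submodule ℂ V, (∀ u ∈ U, ∀ u' ∈ U, B u u' = 0) →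
      LinearMap.range x ≤ U → U ≤ LinearMap.ker x := fun U hU hxU v hv =>
    (horth v).mp fun u => hU _ (hxU ⟨u, rfl⟩) _ hv
  have hPj : finrank ℂ (Submodule.comap (LinearMap.ker x).subtype (LinearMap.range x)) = j :=
    (Submodule.comapSubtypeEquivOfLe hle).finrank_eq.trans hrk
  refine ⟨fun U hU _ hxU => hker U hU hxU, ?_, ?_, ?_⟩
  · rintro U ⟨hU, hUi, hxU⟩
    refine ⟨?_, ?_⟩
    · rintro _ ⟨u, hu, rfl⟩ _ ⟨v, hv, rfl⟩
      exact (hBbar' u v).trans (hU _ hu _ hv)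
    · have h := finrank_map_mkQ_add_finrank
        (Submodule.comap_mono (f := (LinearMap.ker x).subtype) hxU)
      rw [hPj, (Submodule.comapSubtypeEquivOfLe (hker U hU hxU)).finrank_eq, hUi] at h
      exact Nat.eq_sub_of_add_eq h
  · rintro U ⟨hU, -, hxU⟩ U' ⟨hU', -, hxU'⟩ h
    have h' := congrArg (Submodule.comap
      (Submodule.comap (LinearMap.ker x).subtype (LinearMap.range x)).mkQ) h
    simp only [Submodule.comap_map_mkQ] at h'
    rw [sup_eq_right.mpr (Submodule.comap_mono hxU),
      sup_eq_right.mpr (Submodule.comap_mono hxU')] at h'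
    have h'' := congrArg (Submodule.map (LinearMap.ker x).subtype) h'
    simpa only [Submodule.map_comap_subtype, inf_eq_right.mpr (hker U hU hxU),
      inf_eq_right.mpr (hker U' hU' hxU')] using h''
  · rintro W ⟨hW, hWi⟩
    let P := Submodule.comap (LinearMap.ker x).subtype (LinearMap.range x)
    have hPW : P ≤ W.comap P.mkQ := Submodule.le_comap_mkQ P W
    have hmap : (W.comap P.mkQ).map P.mkQ = W :=
      Submodule.map_comap_eq_of_surjective P.mkQ_surjective W
    refine ⟨(W.comap P.mkQ).map (LinearMap.ker x).subtype, ⟨?_, ?_, ?_⟩, ?_⟩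
    · rintro _ ⟨u, hu, rfl⟩ _ ⟨v, hv, rfl⟩
      exact (hBbar' u v).symm.trans (hW _ hu _ hv)
    · have h := finrank_map_mkQ_add_finrank hPW
      rw [hmap, hWi, hPj, Nat.sub_add_cancel hi] at h
      rw [Submodule.finrank_map_subtype_eq, h]
    · intro v hv
      exact ⟨⟨v, hle hv⟩, hPW hv, rfl⟩
    · change Submodule.map P.mkQ (Submodule.comap _ (Submodule.map _ _)) = W
      rw [Submodule.comap_map_eq_of_injective (LinearMap.ker x).injective_subtype, hmap]
end

section
/- Let V be a complex vector space of dimension 2n with a nondegenerate alternating bilinear form ω, and let x ∈ sp(V, ω) satisfy x ∘ x = 0 and rank x = j (so j ≤ n). Then there exist vectors v₁, …, v_j, w₁, …, w_{n−j}, u₁, …, u_{n−j} in V such that: x v_l ≠ 0 and x² v_l = 0 for l ∈ [1, j]; x w_s = x u_s = 0 for s ∈ [1, n−j]; the family (v_l, x v_l, w_s, u_s) is a basis of V; and ω(v_k, v_l) = ω(v_k, w_s) = ω(v_k, u_s) = ω(w_s, w_t) = ω(u_s, u_t) = 0, ω(v_k, x v_l) = δ_{k,l}, ω(w_s, u_t)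 = δ_{s,t}. -/
open Module

section Pairing

variable {K V : Type*} [Field K] [AddCommGroup V] [Module K V]

/-- A family that is dual to another one with respect to a bilinear pairing is linearly
independent. -/
theorem linearIndependent_of_pairing {ι : Type*} [Fintype ι] [DecidableEq ι]
    (ω : V →ₗ[K] V →ₗ[K] K) (f g : ι → V)
    (hfg : ∀ i k, ω (f i) (g k) = if i = k then 1 else 0) : LinearIndependent K g := by
  rw [Fintype.linearIndependent_iff]
  intro c hc i
  have h := congrArg (ω (f i)) hc
  simpa [hfg] using h

/-- The right orthogonal complement of a family `f`. -/
def rightOrthogonal {ι : Type*} (ω : V →ₗ[K] V →ₗ[K] K) (f : ι → V) : Submodule K V :=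
  LinearMap.ker (LinearMap.pi fun i => ω (f i))

theorem mem_rightOrthogonal {ι : Type*} {ω : V →ₗ[K] V →ₗ[K] K} {f : ι → V} {z : V} :
    z ∈ rightOrthogonal ω f ↔ ∀ i, ω (f i) z = 0 := by
  simp [rightOrthogonal, funext_iff]

theorem finrank_rightOrthogonal_add_card [FiniteDimensional K V] {ι : Type*} [Fintype ι]
    [DecidableEq ι] (ω : V →ₗ[K] V →ₗ[K] K) (f g : ι → V)
    (hfg : ∀ i k, ω (f i) (g k) = if i = k then 1 else 0) :
    finrank K (rightOrthogonal ω f) + Fintype.card ι = finrank K V := by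
  have hsurj : LinearMap.range (LinearMap.pi fun i => ω (f i)) = ⊤ := by
    rw [LinearMap.range_eq_top]
    intro c
    refine ⟨∑ k, c k • g k, ?_⟩
    ext i
    simp [hfg]
  have h := (LinearMap.pi fun i => ω (f i)).finrank_range_add_finrank_ker
  rw [hsurj, finrank_top, finrank_fintype_fun_eq_card] at h
  rw [← h, add_comm]
  rfl

theorem eq_zero_of_mem_rightOrthogonal {ι : Type*} [Fintype ι] [DecidableEq ι]
    (ω : V →ₗ[K] V →ₗ[K] K) (hnd : ∀ v : V, (∀ w : V, ω v w = 0) → v = 0) (f g : ι → V)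
    (hfg : ∀ i k, ω (f i) (g k) = if i = k then 1 else 0) {z : V}
    (hzg : ∀ i, ω z (g i) = 0) (hz : ∀ y ∈ rightOrthogonal ω f, ω z y = 0) : z = 0 := by
  refine hnd z fun y => ?_
  have hy : y - ∑ i, ω (f i) y • g i ∈ rightOrthogonal ω f := by
    rw [mem_rightOrthogonal]
    intro i
    simp [hfg]
  simpa [hzg] using hz _ hy

/-- A nondegenerate alternating form has a symplectic basis. -/
theorem exists_symplectic_family (m : ℕ) :
    ∀ (V : Type*) [AddCommGroup V] [Module K V] [FiniteDimensional K V]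
      (ω : V →ₗ[K] V →ₗ[K] K), finrank K V = 2 * m → (∀ v : V, ω v v = 0) →
      (∀ v : V, (∀ w : V, ω v w = 0) → v = 0) →
      ∃ w u : Fin m → V, (∀ s t, ω (w s) (w t) = 0) ∧ (∀ s t, ω (u s) (u t) = 0) ∧
        ∀ s t, ω (w s) (u t) = if s = t then 1 else 0 := by
  induction m with
  | zero =>
    intro V _ _ _ ω _ _ _
    exact ⟨fun _ => 0, fun _ => 0, fun s => s.elim0, fun s => s.elim0, fun s => s.elim0⟩
  | succ m ih =>
    intro V _ _ _ ω hdim halt hnd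
    have hneg : ∀ a b, ω a b = - ω b a := fun a b => (LinearMap.IsAlt.neg halt b a).symm
    have : Nontrivial V := nontrivial_of_finrank_pos (R := K) (by omega)
    obtain ⟨a, ha⟩ := exists_ne (0 : V)
    obtain ⟨b', hb'⟩ : ∃ b', ω a b' ≠ 0 := by
      by_contra! h
      exact ha (hnd a h)
    obtain ⟨b, hab⟩ : ∃ b, ω a b = 1 := ⟨(ω a b')⁻¹ • b', by simp [hb']⟩
    have hba : ω b a = -1 := by rw [hneg, hab]
    have hfg : ∀ i k, ω (![a, b] i) (![b, -a] k) = if i = k then 1 else 0 := by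
      intro i k
      fin_cases i <;> fin_cases k <;> simp [hab, hba, halt]
    set W := rightOrthogonal ω ![a, b]
    have hWa : ∀ z : W, ω a z = 0 := fun z => mem_rightOrthogonal.1 z.2 0
    have hWb : ∀ z : W, ω b z = 0 := fun z => mem_rightOrthogonal.1 z.2 1
    have hWdim : finrank K W = 2 * m := by
      have h : finrank K W + _ = _ := finrank_rightOrthogonal_add_card ω _ _ hfg
      rw [Fintype.card_fin, hdim] at h
      omega
    obtain ⟨w, u, hww, huu, hwu⟩ := ih W (ω.domRestrict₁₂ W W) hWdim (fun v => halt v)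
      (fun z hz => Subtype.ext <| eq_zero_of_mem_rightOrthogonal ω hnd _ _ hfg
        (fun i => by
          rw [hneg]
          fin_cases i
          · simpa using hWb z
          · simpa using hWa z)
        (fun y hy => hz ⟨y, hy⟩))
    simp only [LinearMap.domRestrict₁₂_apply] at hww huu hwu
    refine ⟨Fin.cons a fun s => w s, Fin.cons b fun s => u s, fun s t => ?_, fun s t => ?_,
      fun s t => ?_⟩
    · refine Fin.cases ?_ (fun s => ?_) s <;> refine Fin.cases ?_ (fun t => ?_) t
      · simp [halt]
      · simp [hWa]
      · simp [hneg _ a, hWa]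
      · simp [hww]
    · refine Fin.cases ?_ (fun s => ?_) s <;> refine Fin.cases ?_ (fun t => ?_) t
      · simp [halt]
      · simp [hWb]
      · simp [hneg _ b, hWb]
      · simp [huu]
    · refine Fin.cases ?_ (fun s => ?_) s <;> refine Fin.cases ?_ (fun t => ?_) t
      · simp [hab]
      · simp [hWa, (Fin.succ_ne_zero t).symm]
      · simp [hneg _ b, hWb]
      · simp [hwu]

/-- For `x ∈ sp(V, ω)` the form `(a, b) ↦ ω a (x b)` is symmetric with radical `ker x`; it admits
an orthonormal family indexed by the rank of `x`, and this family detects `ker x`. -/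
theorem exists_orthonormal_family [IsAlgClosed K] [NeZero (2 : K)] [FiniteDimensional K V]
    (ω : V →ₗ[K] V →ₗ[K] K) (halt : ∀ v : V, ω v v = 0)
    (hnd : ∀ v : V, (∀ w : V, ω v w = 0) → v = 0) (x : Module.End K V)
    (hsp : ∀ u v : V, ω (x u) v + ω u (x v) = 0)
    {j : ℕ} (hrk : finrank K (LinearMap.range x) = j) :
    ∃ e : Fin j → V, (∀ k l, ω (e k) (x (e l)) = if k = l then 1 else 0) ∧
      ∀ z, (∀ k, ω (e k) (x z) = 0) → x z = 0 := by
  have hneg : ∀ a b, ω a b = - ω b a := fun a b => (LinearMap.IsAlt.neg halt b a).symm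
  have hsymm : ∀ a b, ω a (x b) = ω b (x a) := fun a b => by
    rw [hneg b, ← eq_neg_of_add_eq_zero_right (hsp a b)]
  obtain ⟨W, hW⟩ := (LinearMap.ker x).exists_isCompl
  have hWdim : finrank K W = j :=
    hrk ▸ (x.kerComplementEquivRange hW.symm).finrank_eq
  have hdetect : ∀ z, (∀ a ∈ W, ω a (x z) = 0) → x z = 0 := by
    intro z hz
    refine hnd _ fun y => ?_
    obtain ⟨b, hb, a, ha, rfl⟩ := Submodule.mem_sup.1 (hW.sup_eq_top ▸ Submodule.mem_top (x := y))
    rw [hneg]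
    simp [hz a ha, hsymm b, LinearMap.mem_ker.1 hb]
  let β : LinearMap.BilinForm K W := (ω.compl₂ x).domRestrict₁₂ W W
  have hβ : ∀ a b : W, β a b = ω a (x b) := fun a b => rfl
  have : Invertible (2 : K) := invertibleOfNonzero (NeZero.ne 2)
  obtain ⟨b₀, hb₀⟩ := LinearMap.BilinForm.exists_orthogonal_basis (B := β)
    ⟨fun a b => hsymm a b⟩
  let b := b₀.reindex (finCongr hWdim)
  have hb : ∀ k l, k ≠ l → ω (b k) (x (b l)) = 0 := fun k l hkl => by
    have h := LinearMap.isOrthoᵢ_def.1 hb₀ ((finCongr hWdim).symm k) ((finCongr hWdim).symm l)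
      (by simpa using hkl)
    simpa [b, hβ] using h
  have hdetect' : ∀ z, (∀ k, ω (b k) (x z) = 0) → x z = 0 := fun z hz => by
    refine hdetect z fun a ha => ?_
    have h : (ω.flip (x z)).comp W.subtype = 0 := b.ext fun k => by simpa using hz k
    simpa using LinearMap.congr_fun h ⟨a, ha⟩
  have hb0 : ∀ k, ω (b k) (x (b k)) ≠ 0 := fun k hk => by
    have h : x (b k) = 0 := hdetect' _ fun l => by
      by_cases hlk : l = k
      · rw [hlk, hk]
      · exact hb l k hlk
    exact b.ne_zero k
      (Subtype.ext (Submodule.disjoint_def.1 hW.disjoint _ (LinearMap.mem_ker.2 h) (b k).2))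
  choose c hc using fun k => IsAlgClosed.exists_pow_nat_eq (ω (b k) (x (b k))) two_pos
  have hc0 : ∀ k, c k ≠ 0 := fun k h => hb0 k (by simp [← hc, h])
  refine ⟨fun k => (c k)⁻¹ • (b k : V), fun k l => ?_, fun z hz => hdetect' z fun k => ?_⟩
  · split_ifs with h
    · subst h
      have := hc0 k
      simp only [map_smul, LinearMap.smul_apply, smul_eq_mul, ← hc]
      field_simp
    · simp [hb k l h]
  · simpa [hc0] using hz k

/-- If moreover `x² = 0`, the orthonormal family can be chosen totally isotropic for `ω`. -/
theorem exists_isotropic_orthonormal_family [IsAlgClosed K] [NeZero (2 : K)]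
    [FiniteDimensional K V]
    (ω : V →ₗ[K] V →ₗ[K] K) (halt : ∀ v : V, ω v v = 0)
    (hnd : ∀ v : V, (∀ w : V, ω v w = 0) → v = 0) (x : Module.End K V)
    (hsp : ∀ u v : V, ω (x u) v + ω u (x v) = 0) (hx : ∀ v, x (x v) = 0)
    {j : ℕ} (hrk : finrank K (LinearMap.range x) = j) :
    ∃ v : Fin j → V, (∀ k l, ω (v k) (v l) = 0) ∧
      (∀ k l, ω (v k) (x (v l)) = if k = l then 1 else 0) ∧
      ∀ z, (∀ k, ω (v k) (x z) = 0) → x z = 0 := by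
  have hneg : ∀ a b, ω a b = - ω b a := fun a b => (LinearMap.IsAlt.neg halt b a).symm
  have hxx : ∀ a b, ω (x a) (x b) = 0 := fun a b => by
    simpa [hx] using hsp a (x b)
  obtain ⟨e, he, hdetect⟩ := exists_orthonormal_family ω halt hnd x hsp hrk
  have he' : ∀ k l, ω (x (e k)) (e l) = - if k = l then 1 else 0 := fun k l => by
    rw [eq_neg_of_add_eq_zero_left (hsp _ _), he]
  have h2 : (2 : K) ≠ 0 := NeZero.ne 2
  refine ⟨fun k => e k + ∑ m, (ω (e k) (e m) / 2) • x (e m), fun k l => ?_, fun k l => ?_,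
    fun z hz => hdetect z fun k => ?_⟩
  · simp [he, he', hxx]
    rw [hneg (e l) (e k)]
    field_simp
    ring
  · simp [he, hx, hxx]
  · simpa [hxx] using hz k

end Pairing

/-- Normal form for an element `x ∈ sp(V, ω)` with `x² = 0` and
`rank x = j` on a `2n`-dimensional symplectic space: there are vectors
`v₁, …, v_j, w₁, …, w_{n−j}, u₁, …, u_{n−j}` such that `x v_l ≠ 0`, `x² v_l = 0`,
`x w_s = x u_s = 0`, the family `(v_l, x v_l, w_s, u_s)` is a basis of `V`, and the
pairings are `ω(v_k, x v_l) = δ_{k l}`, `ω(w_s, u_t) = δ_{s t}`, all others zero. -/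
theorem stmt_5 {V : Type*} [AddCommGroup V] [Module ℂ V] [FiniteDimensional ℂ V]
    (n : ℕ) (hdim : finrank ℂ V = 2 * n)
    (ω : V →ₗ[ℂ] V →ₗ[ℂ] ℂ)
    (halt : ∀ v : V, ω v v = 0)
    (hnd : ∀ v : V, (∀ w : V, ω v w = 0) → v = 0)
    (x : Module.End ℂ V)
    (hsp : ∀ u v : V, ω (x u) v + ω u (x v) = 0)
    (hx2 : x * x = 0)
    (j : ℕ) (hrk : finrank ℂ (LinearMap.range x) = j) (hjn : j ≤ n) :
    ∃ (v : Fin j → V) (w u : Fin (n - j) → V),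
      (∀ l, x (v l) ≠ 0) ∧ (∀ l, x (x (v l)) = 0) ∧
      (∀ s, x (w s) = 0) ∧ (∀ s, x (u s) = 0) ∧
      (∃ b : Basis ((Fin j ⊕ Fin j) ⊕ (Fin (n - j) ⊕ Fin (n - j))) ℂ V,
        (∀ l, b (Sum.inl (Sum.inl l)) = v l) ∧
        (∀ l, b (Sum.inl (Sum.inr l)) = x (v l)) ∧
        (∀ s, b (Sum.inr (Sum.inl s)) = w s) ∧
        (∀ s, b (Sum.inr (Sum.inr s)) = u s)) ∧
      (∀ k l, ω (v k) (v l) = 0) ∧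
      (∀ k s, ω (v k) (w s) = 0) ∧
      (∀ k s, ω (v k) (u s) = 0) ∧
      (∀ s t, ω (w s) (w t) = 0) ∧
      (∀ s t, ω (u s) (u t) = 0) ∧
      (∀ k l, ω (v k) (x (v l)) = if k = l then 1 else 0) ∧
      (∀ s t, ω (w s) (u t) = if s = t then 1 else 0) := by
  have hx : ∀ v, x (x v) = 0 := fun v => LinearMap.congr_fun hx2 v
  have hneg : ∀ a b, ω a b = - ω b a := fun a b => (LinearMap.IsAlt.neg halt b a).symm
  have hxx : ∀ a b, ω (x a) (x b) = 0 := fun a b => by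
    simpa [hx] using hsp a (x b)
  obtain ⟨v, hvv, hvx, hdetect⟩ :=
    exists_isotropic_orthonormal_family ω halt hnd x hsp hx hrk
  have hxv : ∀ k l, ω (x (v k)) (v l) = - if k = l then 1 else 0 := fun k l => by
    rw [eq_neg_of_add_eq_zero_left (hsp _ _), hvx]
  let f : Fin j ⊕ Fin j → V := Sum.elim v fun l => x (v l)
  let g : Fin j ⊕ Fin j → V := Sum.elim (fun l => x (v l)) fun l => - v l
  have hfg : ∀ i k, ω (f i) (g k) = if i = k then 1 else 0 := by
    rintro (i | i) (k | k) <;> simp [f, g, hvv, hvx, hxv, hxx]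
  set W := rightOrthogonal ω f
  have hWv : ∀ (z : W) l, ω (v l) z = 0 := fun z l => mem_rightOrthogonal.1 z.2 (Sum.inl l)
  have hWx : ∀ (z : W) l, ω (x (v l)) z = 0 :=
    fun z l => mem_rightOrthogonal.1 z.2 (Sum.inr l)
  have hWker : ∀ z : W, x z = 0 := fun z => hdetect z fun k => by
    rw [← neg_eq_iff_add_eq_zero.2 (hsp _ _), hWx, neg_zero]
  have hWdim : finrank ℂ W = 2 * (n - j) := by
    have h : finrank ℂ W + _ = _ := finrank_rightOrthogonal_add_card ω f g hfg
    simp only [Fintype.card_sum, Fintype.card_fin, hdim] at h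
    omega
  obtain ⟨w, u, hww, huu, hwu⟩ := exists_symplectic_family (n - j) W (ω.domRestrict₁₂ W W)
    hWdim (fun z => halt z)
    (fun z hz => Subtype.ext <| eq_zero_of_mem_rightOrthogonal ω hnd f g hfg
      (fun i => by
        rw [hneg]
        rcases i with i | i
        · simpa [g] using hWx z i
        · simpa [g] using hWv z i)
      (fun y hy => hz ⟨y, hy⟩))
  simp only [LinearMap.domRestrict₁₂_apply] at hww huu hwu
  have huw : ∀ s t, ω (u s) (w t) = - if t = s then 1 else 0 := fun s t => by
    rw [hneg, hwu]
  have hli : LinearIndependent ℂ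
      (Sum.elim f (Sum.elim (fun s => (w s : V)) fun s => (u s : V))) := by
    refine linearIndependent_of_pairing ω
      (Sum.elim (Sum.elim (fun l => - x (v l)) v)
        (Sum.elim (fun s => - (u s : V)) fun s => (w s : V))) _ ?_
    rintro ((i | i) | (i | i)) ((k | k) | (k | k)) <;>
      simp [f, hvv, hvx, hxv, hxx, hWv, hWx, hww, huu, hwu, huw, hneg _ (v _),
        hneg _ (x (v _)), eq_comm]
  refine ⟨v, fun s => w s, fun s => u s, fun l h => ?_, fun l => hx _, fun s => hWker _,
    fun s => hWker _, ⟨basisOfLinearIndependentOfCardEqFinrank' _ hli ?_, ?_⟩, hvv,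
    fun k s => hWv _ _, fun k s => hWv _ _, hww, huu, hvx, hwu⟩
  · simpa [h] using hvx l l
  · simp only [Fintype.card_sum, Fintype.card_fin, hdim]
    omega
  · simp [f]
end

section
/- In the field ℚ(q) of rational functions over ℚ, define for integers 0 ≤ k ≤ m the Gaussian binomial g_{k,m}(q) = (∏_{l=m−k+1}^{m} (1 − q^l)) / (∏_{l=1}^{k} (1 − q^l)), and let g_{k,m}(q²) denote the same expression with q replaced by q². Then for all integers n ≥ 1 and 0 ≤ i ≤ n the identity ∏_{l=1}^{i} (1 − q^{2(n−i+l)})/(1 − q^{l}) = Σ_{j=0}^{i} q^{(i−j)(i−j+1)/2} · g_{⌊j/2⌋, n}(q²) · g_{i−j, 2n−i−j}(q) holds in ℚ(q). -/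
open Finset

/-- The Gaussian binomial `g_{k,m}(q) = ∏_{l=m−k+1}^{m}(1−q^l) / ∏_{l=1}^{k}(1−q^l)`,
the Poincaré polynomial of the Grassmannian `Gr(k, m)`, as an element of `ℚ(q)`. -/
noncomputable def gPoly (k m : ℕ) : RatFunc ℚ :=
  (∏ l ∈ Finset.Icc (m - k + 1) m, (1 - RatFunc.X ^ l)) /
    ∏ l ∈ Finset.Icc 1 k, (1 - RatFunc.X ^ l)

/-- `g_{k,m}(q²)`: the Gaussian binomial with `q` replaced by `q²`. -/
noncomputable def gPolySq (k m : ℕ) : RatFunc ℚ :=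
  (∏ l ∈ Finset.Icc (m - k + 1) m, (1 - RatFunc.X ^ (2 * l))) /
    ∏ l ∈ Finset.Icc 1 k, (1 - RatFunc.X ^ (2 * l))

section QBinom

variable {K : Type*} [Field K]

/-- The Gaussian binomial `[e + k, k]` at `q`, written as a product of `k` quotients. -/
def qBinom (q : K) (e k : ℕ) : K :=
  ∏ l ∈ range k, (1 - q ^ (e + l + 1)) / (1 - q ^ (l + 1))

/-- `qBinom q e (k - 1)`, with value `0` at `k = 0`. -/
def qBinomPred (q : K) (e : ℕ) : ℕ → K
  | 0 => 0
  | k + 1 => qBinom q e k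

/-- The combined contribution of two consecutive indices `2 * s`, `2 * s + 1` with
`k = i - 2 * s`, without its factor depending on `s`. -/
def qPair (q : K) (e k : ℕ) : K :=
  q ^ (k * (k + 1) / 2) * qBinom q e k + q ^ ((k - 1) * k / 2) * qBinomPred q e k

/-- The product `∏_{l < s} (1 - q^{2(n-l)}) / (1 - r^{l+1})`. -/
def evenProd (q r : K) (n s : ℕ) : K :=
  ∏ l ∈ range s, (1 - q ^ (2 * (n - l))) / (1 - r ^ (l + 1))

theorem qBinom_succ (q : K) (e k : ℕ) :
    qBinom q e (k + 1) = qBinom q e k * ((1 - q ^ (e + k + 1)) / (1 - q ^ (k + 1))) :=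
  prod_range_succ _ _

theorem evenProd_succ (q r : K) (n s : ℕ) :
    evenProd q r n (s + 1) =
      evenProd q r n s * ((1 - q ^ (2 * (n - s))) / (1 - r ^ (s + 1))) :=
  prod_range_succ _ _

theorem succ_mul_succ_succ_div_two (k : ℕ) :
    (k + 1) * (k + 1 + 1) / 2 = k * (k + 1) / 2 + (k + 1) := by
  rw [show (k + 1) * (k + 1 + 1) = k * (k + 1) + (k + 1) * 2 by ring,
    Nat.add_mul_div_right _ _ two_pos]

variable {q : K}

theorem qBinom_succ_left (hq : ∀ l : ℕ, 1 - q ^ (l + 1) ≠ 0) (e k : ℕ) :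
    qBinom q (e + 1) k = qBinom q e k * ((1 - q ^ (e + k + 1)) / (1 - q ^ (e + 1))) := by
  induction k with
  | zero => simp [qBinom, div_self (hq e)]
  | succ k ih =>
    rw [qBinom_succ, qBinom_succ, ih]
    have h1 := hq e
    have h2 := hq k
    rw [show e + 1 + k + 1 = e + (k + 1) + 1 by ring]
    field_simp

theorem qPair_step (hq : ∀ l : ℕ, 1 - q ^ (l + 1) ≠ 0) (e k s : ℕ) :
    (1 - q ^ (k + 2 * s + 1)) * qPair q e (k + 1) - (1 - q ^ (e + 2)) * qPair q (e + 2) k =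
      q ^ ((k + 1) * (k + 2) / 2) * (1 - q ^ (2 * s)) * qBinom q (e + 1) (k + 1) -
        q ^ ((k - 1) * k / 2) * (1 - q ^ (2 * (k + s + 1) + e)) * qBinomPred q (e + 1) k := by
  have h1 := hq e
  have h2 := hq (e + 1)
  cases k with
  | zero =>
    have h0 := hq 0
    simp [qPair, qBinomPred, qBinom] at h0 ⊢
    field_simp
    ring
  | succ k =>
    have h3 := hq k
    have h4 := hq (k + 1)
    simp only [qPair, qBinomPred, Nat.add_sub_cancel, qBinom_succ_left hq, qBinom_succ,
      succ_mul_succ_succ_div_two]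
    generalize qBinom q e k = b
    generalize k * (k + 1) / 2 = t
    simp only [pow_add, pow_mul', mul_add, pow_one] at h1 h2 h3 h4 ⊢
    generalize q ^ e = a at *
    generalize q ^ k = x at *
    generalize q ^ s = y at *
    have h1' : 1 - q * a ≠ 0 := by rwa [mul_comm]
    have h2' : 1 - q ^ 2 * a ≠ 0 := by rwa [mul_comm, pow_two, ← mul_assoc]
    have h4' : 1 - x * q ^ 2 ≠ 0 := by rwa [pow_two, ← mul_assoc]
    field_simp
    ring

theorem sum_qPair_step (hq : ∀ l : ℕ, 1 - q ^ (l + 1) ≠ 0) (d i s k : ℕ)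
    (hi : i = k + 2 * s) :
    ∑ u ∈ range (s + 1), evenProd q (q ^ 2) (i + 1 + d) u *
        ((1 - q ^ (i + 1)) * qPair q (2 * d) (i + 1 - 2 * u) -
          (1 - q ^ (2 * d + 2)) * qPair q (2 * d + 2) (i - 2 * u)) =
      -(evenProd q (q ^ 2) (i + 1 + d) s * q ^ ((k - 1) * k / 2) *
        (1 - q ^ (2 * (i + 1 + d - s))) * qBinomPred q (2 * d + 1) k) := by
  induction s generalizing k with
  | zero =>
    subst hi
    have := qPair_step hq (2 * d) i 0
    simp only [zero_add, range_one, sum_singleton, mul_zero, add_zero, Nat.sub_zero] at this ⊢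
    rw [this, show 2 * (i + 1) + 2 * d = 2 * (i + 1 + d) by ring]
    ring
  | succ s ih =>
    rw [sum_range_succ, ih (k + 2) (by omega), evenProd_succ,
      show i + 1 - 2 * (s + 1) = k + 1 by omega, show i - 2 * (s + 1) = k by omega,
      show i + 1 = k + 2 * (s + 1) + 1 by omega, qPair_step hq,
      show 2 * (k + (s + 1) + 1) + 2 * d = 2 * (k + 2 * (s + 1) + 1 + d - (s + 1)) by omega]
    have h := hq (2 * s + 1)
    rw [show 2 * s + 1 + 1 = 2 * (s + 1) by ring] at h
    rw [← pow_mul]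
    simp only [qBinomPred, show k + 2 - 1 = k + 1 by omega]
    field_simp
    ring

/-- The paired sums satisfy the first-order recurrence of the product side. -/
theorem sum_qPair_succ (hq : ∀ l : ℕ, 1 - q ^ (l + 1) ≠ 0) (d i : ℕ) :
    (1 - q ^ (i + 1)) * ∑ u ∈ range ((i + 1) / 2 + 1),
        evenProd q (q ^ 2) (i + 1 + d) u * qPair q (2 * d) (i + 1 - 2 * u) =
      (1 - q ^ (2 * d + 2)) * ∑ u ∈ range (i / 2 + 1),
        evenProd q (q ^ 2) (i + 1 + d) u * qPair q (2 * d + 2) (i - 2 * u) := by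
  have key := fun k => sum_qPair_step hq d i (i / 2) k
  simp only [mul_sub, sum_sub_distrib, mul_left_comm (evenProd _ _ _ _), ← mul_sum] at key
  rcases Nat.even_or_odd' i with ⟨p, rfl | rfl⟩
  · have := key 0 (by omega)
    simp only [qBinomPred, mul_zero, neg_zero] at this
    rw [show (2 * p + 1) / 2 = 2 * p / 2 by omega]
    exact sub_eq_zero.1 this
  · have := key 1 (by omega)
    rw [sub_eq_iff_eq_add] at this
    rw [show (2 * p + 1 + 1) / 2 = (2 * p + 1) / 2 + 1 by omega, sum_range_succ, mul_add, this,
      show (2 * p + 1) / 2 = p by omega, evenProd_succ,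
      show 2 * p + 1 + 1 - 2 * (p + 1) = 0 by omega, ← pow_mul,
      show 2 * (p + 1) = 2 * p + 1 + 1 by ring]
    have h := hq (2 * p + 1)
    simp [qPair, qBinom, qBinomPred]
    field_simp
    ring

theorem evenProd_eq_sum_qPair (hq : ∀ l : ℕ, 1 - q ^ (l + 1) ≠ 0) (i d : ℕ) :
    evenProd q q (i + d) i = ∑ u ∈ range (i / 2 + 1),
      evenProd q (q ^ 2) (i + d) u * qPair q (2 * d) (i - 2 * u) := by
  induction i generalizing d with
  | zero => simp [evenProd, qPair, qBinom, qBinomPred]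
  | succ i ih =>
    have h := hq i
    refine mul_left_cancel₀ h ?_
    rw [sum_qPair_succ hq, evenProd_succ, show i + 1 + d = i + (d + 1) by ring, ih (d + 1),
      show i + (d + 1) - i = d + 1 by omega, show 2 * (d + 1) = 2 * d + 2 by ring]
    field_simp

end QBinom

theorem sum_range_two_mul {M : Type*} [AddCommMonoid M] (f : ℕ → M) (p : ℕ) :
    ∑ j ∈ range (2 * p), f j = ∑ s ∈ range p, (f (2 * s) + f (2 * s + 1)) := by
  induction p with
  | zero => simp
  | succ p ih => rw [Nat.mul_succ, sum_range_succ, sum_range_succ, ih, sum_range_succ, add_assoc]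

theorem sum_range_eq_sum_pairs {M : Type*} [AddCommMonoid M] (f : ℕ → M) (i : ℕ)
    (hf : f (i + 1) = 0) :
    ∑ j ∈ range (i + 1), f j = ∑ s ∈ range (i / 2 + 1), (f (2 * s) + f (2 * s + 1)) := by
  rw [← sum_range_two_mul]
  rcases Nat.even_or_odd' i with ⟨p, rfl | rfl⟩
  · rw [show 2 * (2 * p / 2 + 1) = 2 * p + 1 + 1 by omega, sum_range_succ _ (2 * p + 1), hf,
      add_zero]
  · rw [show 2 * ((2 * p + 1) / 2 + 1) = 2 * p + 1 + 1 by omega]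

theorem prod_Icc_add_one_eq_prod_range {M : Type*} [CommMonoid M] (f : ℕ → M) (a k : ℕ) :
    ∏ l ∈ Icc (a + 1) (a + k), f l = ∏ l ∈ range k, f (a + l + 1) := by
  induction k with
  | zero => simp
  | succ k ih => rw [← add_assoc, prod_Icc_succ_top (by omega), ih, prod_range_succ]

theorem prod_range_sub_eq {M : Type*} [CommMonoid M] (f : ℕ → M) (a k : ℕ) :
    ∏ l ∈ range k, f (a + l + 1) = ∏ l ∈ range k, f (a + k - l) := by
  rw [← prod_range_reflect]
  refine prod_congr rfl fun l hl => ?_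
  rw [mem_range] at hl
  congr 1
  omega

theorem prod_Icc_one_eq_prod_range {M : Type*} [CommMonoid M] (f : ℕ → M) (k : ℕ) :
    ∏ l ∈ Icc 1 k, f l = ∏ l ∈ range k, f (l + 1) := by
  simpa using prod_Icc_add_one_eq_prod_range f 0 k

theorem gPoly_eq_qBinom (e k : ℕ) : gPoly k (e + k) = qBinom RatFunc.X e k := by
  rw [gPoly, Nat.add_sub_cancel, prod_Icc_add_one_eq_prod_range, prod_Icc_one_eq_prod_range,
    qBinom, prod_div_distrib]

theorem gPolySq_eq_evenProd {s n : ℕ} (h : s ≤ n) :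
    gPolySq s n = evenProd RatFunc.X (RatFunc.X ^ 2) n s := by
  obtain ⟨a, rfl⟩ := Nat.exists_eq_add_of_le' h
  rw [gPolySq, Nat.add_sub_cancel, prod_Icc_add_one_eq_prod_range, prod_Icc_one_eq_prod_range,
    prod_range_sub_eq (fun l => 1 - (RatFunc.X : RatFunc ℚ) ^ (2 * l)), evenProd,
    prod_div_distrib]
  simp only [pow_mul]

theorem one_sub_ratFuncX_pow_ne_zero (l : ℕ) : 1 - (RatFunc.X : RatFunc ℚ) ^ (l + 1) ≠ 0 := by
  rw [← RatFunc.algebraMap_X, ← map_pow, ← map_one (algebraMap (Polynomial ℚ) (RatFunc ℚ)),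
    ← map_sub]
  refine RatFunc.algebraMap_ne_zero fun h => ?_
  simpa using congrArg (Polynomial.eval 0) h

/-- For `1 ≤ n` and `i ≤ n`, in `ℚ(q)`:
`∏_{l=1}^{i} (1 − q^{2(n−i+l)})/(1 − q^l)
  = ∑_{j=0}^{i} q^{(i−j)(i−j+1)/2} · g_{⌊j/2⌋,n}(q²) · g_{i−j,2n−i−j}(q)`.
The left-hand side is the Poincaré polynomial of `OGr(i, 2n+1)`. -/
theorem stmt_6 (n i : ℕ) (hn : 1 ≤ n) (hi : i ≤ n) :
    (∏ l ∈ Finset.Icc 1 i,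
        (1 - RatFunc.X ^ (2 * (n - i + l))) / (1 - (RatFunc.X : RatFunc ℚ) ^ l)) =
      ∑ j ∈ Finset.range (i + 1),
        RatFunc.X ^ ((i - j) * (i - j + 1) / 2) * gPolySq (j / 2) n *
          gPoly (i - j) (2 * n - i - j) := by
  obtain ⟨d, rfl⟩ := Nat.exists_eq_add_of_le hi
  have hsum : ∀ j ∈ range (i + 1),
      RatFunc.X ^ ((i - j) * (i - j + 1) / 2) * gPolySq (j / 2) (i + d) *
          gPoly (i - j) (2 * (i + d) - i - j) =
        RatFunc.X ^ ((i - j) * (i - j + 1) / 2) *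
          evenProd RatFunc.X (RatFunc.X ^ 2) (i + d) (j / 2) *
          qBinomPred RatFunc.X (2 * d) (i + 1 - j) := by
    intro j hj
    rw [mem_range] at hj
    rw [gPolySq_eq_evenProd (by omega), show 2 * (i + d) - i - j = 2 * d + (i - j) by omega,
      gPoly_eq_qBinom, show i + 1 - j = i - j + 1 by omega, qBinomPred]
  rw [sum_congr rfl hsum, sum_range_eq_sum_pairs _ _ (by simp [qBinomPred])]
  trans evenProd RatFunc.X RatFunc.X (i + d) i
  · rw [prod_Icc_one_eq_prod_range, evenProd, prod_div_distrib, prod_div_distrib, add_comm i d,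
      Nat.add_sub_cancel]
    congr 1
    exact prod_range_sub_eq (fun l => 1 - (RatFunc.X : RatFunc ℚ) ^ (2 * l)) d i
  · rw [evenProd_eq_sum_qPair one_sub_ratFuncX_pow_ne_zero]
    refine sum_congr rfl fun s hs => ?_
    rw [mem_range] at hs
    obtain ⟨k, hk⟩ : ∃ k, i = k + 2 * s := ⟨i - 2 * s, by omega⟩
    rw [show 2 * s / 2 = s by omega, show (2 * s + 1) / 2 = s by omega,
      show i + 1 - 2 * s = k + 1 by omega, show i + 1 - (2 * s + 1) = k by omega,
      show i - 2 * s = k by omega, show i - (2 * s + 1) = k - 1 by omega]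
    cases k with
    | zero => simp [qPair, qBinomPred, qBinom]
    | succ k =>
      simp only [qPair, qBinomPred, Nat.add_sub_cancel]
      ring
end

section
/- Let V = ℂ^{2n+1} with a nondegenerate symmetric bilinear form B, and let x : V → V be a B-self-adjoint endomorphism having 2n+1 pairwise distinct eigenvalues λ₁, …, λ_{2n+1}. On W = V × ℂ define symmetric bilinear forms B̃((v,a),(v',a')) = B(v, v') and B̃_x((v,a),(v',a')) = B(x v, v') + a·a'. Then for every pair (s, t) ∈ ℂ² with (s, t) ≠ (0, 0), the symmetric bilinear form s·B̃ + t·B̃_x on W is degenerate if and only if t = 0 or s + t·λ_i = 0 for some i. In particular, the pencil spanned by B̃ and B̃_x contains exactly 2n+2 degenerate members up to scalar. -/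
open Module

/-- An endomorphism of a `d`-dimensional space with `d` distinct eigenvalues has no others. -/
theorem Module.End.HasEigenvalue.mem_range_of_injective {K V ι : Type*} [Field K]
    [AddCommGroup V] [Module K V] [FiniteDimensional K V] [Fintype ι] {x : Module.End K V}
    {lam : ι → K} (hcard : finrank K V = Fintype.card ι) (hinj : Function.Injective lam)
    (heig : ∀ i, x.HasEigenvalue (lam i)) {μ : K} (hμ : x.HasEigenvalue μ) :
    μ ∈ Set.range lam := by
  by_contra hmem
  choose v hv using fun i => (heig i).exists_hasEigenvector
  obtain ⟨u, hu⟩ := hμ.exists_hasEigenvector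
  have hinj' : Function.Injective (fun o : Option ι => o.elim μ lam) := by
    rintro (_ | i) (_ | j) h
    · rfl
    · exact (hmem ⟨j, h.symm⟩).elim
    · exact (hmem ⟨i, h⟩).elim
    · exact congrArg some (hinj h)
  have hli := Module.End.eigenvectors_linearIndependent' x _ hinj' (fun o => o.elim u v)
    (by rintro (_ | i); exacts [hu, hv i])
  have := hli.fintype_card_le_finrank
  rw [Fintype.card_option] at this
  omega

/-- Degeneracy of the form `s·B + t·B(x·, ·)` extended by `t` on an orthogonal line. -/
theorem exists_ne_zero_pencil_eq_zero_iff {K V : Type*} [Field K] [AddCommGroup V] [Module K V]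
    {B : V →ₗ[K] V →ₗ[K] K} (hnd : ∀ v : V, (∀ w : V, B v w = 0) → v = 0)
    (x : Module.End K V) (s t : K) :
    (∃ w : V × K, w ≠ 0 ∧ ∀ w' : V × K,
      s * B w.1 w'.1 + t * (B (x w.1) w'.1 + w.2 * w'.2) = 0) ↔
      t = 0 ∨ ∃ μ, x.HasEigenvalue μ ∧ s + t * μ = 0 := by
  constructor
  · rintro ⟨⟨v, a⟩, hw, h⟩
    refine or_iff_not_imp_left.2 fun ht => ?_
    have ha : a = 0 := by simpa [ht] using h (0, 1)
    have hv : v ≠ 0 := by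
      rintro rfl
      exact hw (by simp [ha])
    have hx : s • v + t • x v = 0 := hnd _ fun u => by simpa using h (u, 0)
    refine ⟨-s / t, Module.End.hasEigenvalue_of_hasEigenvector
      (Module.End.hasEigenvector_iff.2 ⟨Module.End.mem_eigenspace_iff.2 ?_, hv⟩), ?_⟩
    · rw [div_eq_inv_mul, mul_smul, eq_inv_smul_iff₀ ht, neg_smul]
      exact eq_neg_of_add_eq_zero_right hx
    · field_simp
      ring
  · rintro (rfl | ⟨μ, hμ, hst⟩)
    · exact ⟨(0, 1), by simp, by simp⟩
    · obtain ⟨v, hv⟩ := hμ.exists_hasEigenvector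
      refine ⟨(v, 0), by simp [hv.2], fun w' => ?_⟩
      simp only [hv.apply_eq_smul, map_smul, LinearMap.smul_apply, smul_eq_mul]
      linear_combination B v w'.1 * hst

/-- The lines of `K²` spanned by `(1, 0)` and by the vectors `(-λᵢ, 1)`, with `λ` injective,
are pairwise distinct. -/
theorem ncard_setOf_span_pair {K ι : Type*} [Field K] [Fintype ι] {lam : ι → K}
    (hinj : Function.Injective lam) :
    {l : Submodule K (K × K) | ∃ s t : K, (s, t) ≠ (0, 0) ∧
      (t = 0 ∨ ∃ i, s + t * lam i = 0) ∧ l = Submodule.span K {(s, t)}}.ncard =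
      Fintype.card ι + 1 := by
  let p : Option ι → K × K := fun o => o.elim (1, 0) fun i => (-lam i, 1)
  have hp : Function.Injective fun o => Submodule.span K {p o} := by
    intro a b h
    have hmem : p a ∈ Submodule.span K {p b} :=
      h.le (Submodule.mem_span_singleton_self (p a))
    obtain ⟨r, hr⟩ := Submodule.mem_span_singleton.1 hmem
    rcases a with _ | i <;> rcases b with _ | j <;> simp [p] at hr ⊢
    · simp [hr.2] at hr
    · obtain ⟨hr, rfl⟩ := hr
      exact (hinj (by simpa using hr)).symm
  have hrange : {l : Submodule K (K × K) | ∃ s t : K, (s, t) ≠ (0, 0) ∧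
      (t = 0 ∨ ∃ i, s + t * lam i = 0) ∧ l = Submodule.span K {(s, t)}} =
      Set.range fun o => Submodule.span K {p o} := by
    ext l
    constructor
    · rintro ⟨s, t, hne, h, rfl⟩
      by_cases ht : t = 0
      · subst ht
        have hs : s ≠ 0 := by simpa using hne
        refine ⟨none, ?_⟩
        simpa [p] using (Submodule.span_singleton_smul_eq hs.isUnit ((1, 0) : K × K)).symm
      · obtain ⟨i, hi⟩ := h.resolve_left ht
        refine ⟨some i, ?_⟩
        have hst : (s, t) = t • p (some i) := by
          simp [p, eq_neg_of_add_eq_zero_left hi]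
        rw [hst, Submodule.span_singleton_smul_eq (Ne.isUnit ht)]
    · rintro ⟨_ | i, rfl⟩
      · exact ⟨1, 0, by simp, Or.inl rfl, rfl⟩
      · exact ⟨-lam i, 1, by simp, Or.inr ⟨i, by ring⟩, rfl⟩
  rw [hrange, ← Set.image_univ, Set.ncard_image_of_injective _ hp, Set.ncard_univ,
    Nat.card_eq_fintype_card, Fintype.card_option]

/-- Let `dim V = 2n+1`, `B` a nondegenerate symmetric bilinear form, and
`x` a `B`-self-adjoint endomorphism with `2n+1` pairwise distinct eigenvalues
`λ₁, …, λ_{2n+1}`.  On `W = V × ℂ` consider `B̃((v,a),(v',a')) = B(v,v')` and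
`B̃ₓ((v,a),(v',a')) = B(xv, v') + a·a'`.  Then for `(s,t) ≠ (0,0)` the form
`s·B̃ + t·B̃ₓ` is degenerate iff `t = 0` or `s + t·λᵢ = 0` for some `i`; in particular the
pencil spanned by `B̃` and `B̃ₓ` contains exactly `2n+2` degenerate members up to scalar
(i.e. the degenerate parameters `(s,t) ≠ (0,0)` span exactly `2n+2` lines in `ℂ²`). -/
theorem stmt_9 {V : Type*} [AddCommGroup V] [Module ℂ V] [FiniteDimensional ℂ V]
    (n : ℕ) (hdim : finrank ℂ V = 2 * n + 1)
    (B : V →ₗ[ℂ] V →ₗ[ℂ] ℂ)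
    (hsymm : ∀ u v : V, B u v = B v u)
    (hnd : ∀ v : V, (∀ w : V, B v w = 0) → v = 0)
    (x : Module.End ℂ V)
    (hsa : ∀ u v : V, B (x u) v = B u (x v))
    (lam : Fin (2 * n + 1) → ℂ) (hinj : Function.Injective lam)
    (heig : ∀ i, ∃ v : V, v ≠ 0 ∧ x v = lam i • v) :
    ∀ degen : ℂ → ℂ → Prop,
      (∀ s t : ℂ, degen s t ↔ ∃ w : V × ℂ, w ≠ 0 ∧ ∀ w' : V × ℂ,
          s * B w.1 w'.1 + t * (B (x w.1) w'.1 + w.2 * w'.2) = 0) →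
      (∀ s t : ℂ, (s, t) ≠ (0, 0) →
        (degen s t ↔ t = 0 ∨ ∃ i, s + t * lam i = 0)) ∧
      ({l : Submodule ℂ (ℂ × ℂ) | ∃ s t : ℂ, (s, t) ≠ (0, 0) ∧ degen s t ∧
          l = Submodule.span ℂ {(s, t)}}).ncard = 2 * n + 2 := by
  intro degen hdegen
  have heig' : ∀ i, x.HasEigenvalue (lam i) := fun i => by
    obtain ⟨v, hv, hxv⟩ := heig i
    exact Module.End.hasEigenvalue_of_hasEigenvector
      (Module.End.hasEigenvector_iff.2 ⟨Module.End.mem_eigenspace_iff.2 hxv, hv⟩)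
  have key : ∀ s t : ℂ, degen s t ↔ t = 0 ∨ ∃ i, s + t * lam i = 0 := fun s t => by
    rw [hdegen, exists_ne_zero_pencil_eq_zero_iff hnd]
    refine or_congr_right ⟨?_, fun ⟨i, hi⟩ => ⟨lam i, heig' i, hi⟩⟩
    rintro ⟨μ, hμ, hst⟩
    obtain ⟨i, rfl⟩ := hμ.mem_range_of_injective (by simpa using hdim) hinj heig'
    exact ⟨i, hst⟩
  refine ⟨fun s t _ => key s t, ?_⟩
  simp only [key]
  rw [ncard_setOf_span_pair hinj, Fintype.card_fin]
end

section
/- Let V = ℂ^{2n+1} with a nondegenerate symmetric bilinear form B. Let y : V → V be a B-self-adjoint endomorphism whose characteristic polynomial is ∏_{i=1}^{n} (t − a_i)² · (t − b), where a₁, …, a_n, b are pairwise distinct complex numbers, and assume dim ker(y − a_i · id) = 1 for every i. Then there exists exactly one n-dimensional subspace U of V that is B-isotropic and y-invariant (y U ⊆ U). -/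
open Module Polynomial

section SelfAdjoint

variable {K V : Type*} [Field K] [AddCommGroup V] [Module K V]
  {B : V →ₗ[K] V →ₗ[K] K} {y : Module.End K V}

/-- Polynomials in a self-adjoint endomorphism are self-adjoint. -/
theorem aeval_selfAdjoint (hsa : ∀ u v : V, B (y u) v = B u (y v)) (p : K[X]) (u v : V) :
    B (aeval y p u) v = B u (aeval y p v) := by
  induction p using Polynomial.induction_on' generalizing u v with
  | add p q hp hq => simp [hp, hq]
  | monomial k c =>
    have hpow : ∀ (k : ℕ) (u v : V), B ((y ^ k) u) v = B u ((y ^ k) v) := by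
      intro k
      induction k with
      | zero => simp
      | succ k ih =>
        intro u v
        rw [pow_succ, Module.End.mul_apply, ih, hsa, ← Module.End.mul_apply, ← pow_succ', pow_succ,
          Module.End.mul_apply]
    simp [aeval_monomial, hpow]

/-- Distinct generalized eigenspaces of a self-adjoint endomorphism are orthogonal. -/
theorem orthogonal_of_mem_maxGenEigenspace (hsa : ∀ u v : V, B (y u) v = B u (y v))
    {μ ν : K} (hμν : μ ≠ ν) {x z : V} (hx : x ∈ y.maxGenEigenspace μ)
    (hz : z ∈ y.maxGenEigenspace ν) : B x z = 0 := by
  obtain ⟨k, hk⟩ := (Module.End.mem_maxGenEigenspace _ _ _).1 hx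
  obtain ⟨l, hl⟩ := (Module.End.mem_maxGenEigenspace _ _ _).1 hz
  have haeval : ∀ (c : K) (m : ℕ), aeval y ((X - C c) ^ m) = (y - c • (1 : Module.End K V)) ^ m := by
    intro c m
    simp [Algebra.algebraMap_eq_smul_one]
  obtain ⟨r, s, hrs⟩ : IsCoprime ((X - C μ) ^ k) ((X - C ν) ^ l) :=
    (isCoprime_X_sub_C_of_isUnit_sub (sub_ne_zero.2 hμν).isUnit).pow
  have hz' : aeval y ((X - C μ) ^ k) (aeval y r z) = z := by
    have h := congrArg (fun p => aeval y p z) hrs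
    simp only [map_add, map_mul, LinearMap.add_apply, Module.End.mul_apply, haeval, hl, map_zero,
      add_zero, map_one, Module.End.one_apply] at h
    rw [← Module.End.mul_apply, ← map_mul, mul_comm, map_mul, Module.End.mul_apply, haeval, h]
  rw [← hz', ← aeval_selfAdjoint hsa, haeval, hk]
  simp

/-- A nonzero invariant subspace of a generalized eigenspace contains an eigenvector. -/
theorem exists_eigenvector_of_le_maxGenEigenspace {μ : K} {W : Submodule K V}
    (hW : ∀ w ∈ W, y w ∈ W) (hle : W ≤ y.maxGenEigenspace μ) (hne : W ≠ ⊥) :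
    ∃ w ∈ W, w ≠ 0 ∧ w ∈ LinearMap.ker (y - μ • (1 : Module.End K V)) := by
  obtain ⟨v, hv, hv0⟩ := W.exists_mem_ne_zero_of_ne_bot hne
  obtain ⟨k, hk⟩ := (Module.End.mem_maxGenEigenspace _ _ _).1 (hle hv)
  induction k generalizing v with
  | zero => exact absurd (by simpa using hk) hv0
  | succ k ih =>
    by_cases h0 : (y - μ • (1 : Module.End K V)) v = 0
    · exact ⟨v, hv, hv0, h0⟩
    · refine ih _ ?_ h0 ?_
      · simpa using W.sub_mem (hW v hv) (W.smul_mem μ hv)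
      · rw [← Module.End.mul_apply, ← pow_succ, hk]

/-- If the `μ`-eigenspace is a line, a nonzero invariant subspace of the generalized eigenspace
contains it. -/
theorem ker_le_of_le_maxGenEigenspace {μ : K} {W : Submodule K V}
    (hker : finrank K (LinearMap.ker (y - μ • (1 : Module.End K V))) = 1)
    (hW : ∀ w ∈ W, y w ∈ W) (hle : W ≤ y.maxGenEigenspace μ) (hne : W ≠ ⊥) :
    LinearMap.ker (y - μ • (1 : Module.End K V)) ≤ W := by
  obtain ⟨w, hw, hw0, hwk⟩ := exists_eigenvector_of_le_maxGenEigenspace hW hle hne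
  intro v hv
  obtain ⟨c, hc⟩ := exists_smul_eq_of_finrank_eq_one hker (x := ⟨w, hwk⟩) (by simpa using hw0)
    ⟨v, hv⟩
  have hcv : c • w = v := congrArg Subtype.val hc
  exact hcv ▸ W.smul_mem c hw

theorem maxGenEigenspace_invariant (y : Module.End K V) (μ : K) :
    ∀ v ∈ y.maxGenEigenspace μ, y v ∈ y.maxGenEigenspace μ :=
  fun _ hv => Module.End.mapsTo_maxGenEigenspace_of_comm (Commute.refl y) μ hv

theorem ker_le_maxGenEigenspace (y : Module.End K V) (μ : K) :
    LinearMap.ker (y - μ • (1 : Module.End K V)) ≤ y.maxGenEigenspace μ :=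
  fun _ hv => (Module.End.mem_maxGenEigenspace _ _ _).2 ⟨1, by simpa using hv⟩

/-- If a one-dimensional eigenspace is properly contained in its generalized eigenspace,
then it is isotropic. -/
theorem isotropic_ker_of_lt_finrank (hsa : ∀ u v : V, B (y u) v = B u (y v)) {μ : K}
    (hker : finrank K (LinearMap.ker (y - μ • (1 : Module.End K V))) = 1)
    (hlt : 1 < finrank K (y.maxGenEigenspace μ)) {u v : V}
    (hu : u ∈ LinearMap.ker (y - μ • (1 : Module.End K V)))
    (hv : v ∈ LinearMap.ker (y - μ • (1 : Module.End K V))) : B u v = 0 := by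
  have hnle : ¬ y.maxGenEigenspace μ ≤ LinearMap.ker (y - μ • (1 : Module.End K V)) := by
    intro h
    rw [h.antisymm (ker_le_maxGenEigenspace y μ), hker] at hlt
    exact hlt.false
  obtain ⟨x, hx, hxk⟩ := SetLike.not_le_iff_exists.1 hnle
  have hcomm : ∀ w, y ((y - μ • (1 : Module.End K V)) w) = (y - μ • (1 : Module.End K V)) (y w) := by
    intro w
    simp
  have hrange := ker_le_of_le_maxGenEigenspace
    (W := LinearMap.range (y - μ • (1 : Module.End K V)) ⊓ y.maxGenEigenspace μ) hker
    (by
      rintro _ ⟨⟨w, rfl⟩, hw⟩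
      exact ⟨⟨y w, (hcomm w).symm⟩, maxGenEigenspace_invariant y μ _ hw⟩) inf_le_right
    (by
      refine Submodule.ne_bot_iff _ |>.2 ⟨(y - μ • (1 : Module.End K V)) x, ⟨⟨x, rfl⟩, ?_⟩, hxk⟩
      simpa using Submodule.sub_mem _ (maxGenEigenspace_invariant y μ x hx)
        (Submodule.smul_mem _ μ hx))
  obtain ⟨w, rfl⟩ := (hrange hv).1
  have hadj : B u ((y - μ • (1 : Module.End K V)) w) = B ((y - μ • (1 : Module.End K V)) u) w := by
    simp [hsa]
  rw [hadj, LinearMap.mem_ker.1 hu]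
  simp

/-- An isotropic subspace contains no nonzero full generalized eigenspace of a self-adjoint
endomorphism. -/
theorem maxGenEigenspace_eq_bot_of_le_isotropic [IsAlgClosed K] [FiniteDimensional K V]
    (hnd : ∀ v : V, (∀ w : V, B v w = 0) → v = 0)
    (hsa : ∀ u v : V, B (y u) v = B u (y v)) {U : Submodule K V}
    (hU : ∀ u ∈ U, ∀ u' ∈ U, B u u' = 0) {μ : K} (hle : y.maxGenEigenspace μ ≤ U) :
    y.maxGenEigenspace μ = ⊥ := by
  refine (Submodule.eq_bot_iff _).2 fun v hv => hnd v fun w => ?_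
  have htop : (⊤ : Submodule K V) ≤ LinearMap.ker (B v) := by
    rw [← Module.End.iSup_maxGenEigenspace_eq_top y]
    refine iSup_le fun ν z hz => ?_
    rcases eq_or_ne μ ν with rfl | hμν
    · exact hU v (hle hv) z (hle hz)
    · exact orthogonal_of_mem_maxGenEigenspace hsa hμν hv hz
  exact htop (Submodule.mem_top (x := w))

/-- If the generalized eigenspace for `μ` is at most two-dimensional, its intersection with an
invariant isotropic subspace consists of eigenvectors. -/
theorem isotropic_inf_maxGenEigenspace_le_ker [IsAlgClosed K] [FiniteDimensional K V]
    (hnd : ∀ v : V, (∀ w : V, B v w = 0) → v = 0)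
    (hsa : ∀ u v : V, B (y u) v = B u (y v)) {U : Submodule K V}
    (hU : ∀ u ∈ U, ∀ u' ∈ U, B u u' = 0) (hyU : ∀ u ∈ U, y u ∈ U) {μ : K}
    (hker : finrank K (LinearMap.ker (y - μ • (1 : Module.End K V))) = 1)
    (hdim : finrank K (y.maxGenEigenspace μ) ≤ 2) :
    U ⊓ y.maxGenEigenspace μ ≤ LinearMap.ker (y - μ • (1 : Module.End K V)) := by
  by_cases hbot : U ⊓ y.maxGenEigenspace μ = ⊥
  · simp [hbot]
  have hle := ker_le_of_le_maxGenEigenspace hker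
    (fun w hw => Submodule.mem_inf.2 ⟨hyU w hw.1, maxGenEigenspace_invariant y μ w hw.2⟩) inf_le_right hbot
  have hlt : U ⊓ y.maxGenEigenspace μ < y.maxGenEigenspace μ := by
    refine lt_of_le_of_ne inf_le_right fun h => hbot ?_
    rw [maxGenEigenspace_eq_bot_of_le_isotropic hnd hsa hU (inf_eq_right.1 h), inf_bot_eq]
  have hfin := Submodule.finrank_lt_finrank_of_lt hlt
  exact (Submodule.eq_of_le_of_finrank_le hle (by lia)).ge

end SelfAdjoint

theorem rootMultiplicity_prod_X_sub_C_sq_mul {K ι : Type*} [Field K] [DecidableEq K] [Fintype ι]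
    (a : ι → K) (b x : K) :
    rootMultiplicity x ((∏ i, (X - C (a i)) ^ 2) * (X - C b)) =
      (∑ i, if x = a i then 2 else 0) + if x = b then 1 else 0 := by
  have hprod : (∏ i, (X - C (a i)) ^ 2) ≠ 0 :=
    Finset.prod_ne_zero_iff.2 fun i _ => pow_ne_zero 2 (X_sub_C_ne_zero (a i))
  rw [rootMultiplicity_mul (mul_ne_zero hprod (X_sub_C_ne_zero b)), rootMultiplicity_X_sub_C,
    ← count_roots, roots_prod _ _ hprod, Multiset.count_bind]
  congr 1
  refine congrArg Multiset.sum (Multiset.map_congr rfl fun i _ => ?_)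
  simp [roots_pow, Multiset.count_singleton]

/-- Let `dim V = 2n+1`, `B` a nondegenerate symmetric bilinear form,
and `y` a `B`-self-adjoint endomorphism with characteristic polynomial
`∏_{i=1}^{n} (t − aᵢ)² · (t − b)` for pairwise distinct `a₁, …, a_n, b`, such that each
eigenspace `ker(y − aᵢ)` is one-dimensional.  Then there is exactly one `n`-dimensional
subspace of `V` that is `B`-isotropic and `y`-invariant. -/
theorem stmt_11 {V : Type*} [AddCommGroup V] [Module ℂ V] [FiniteDimensional ℂ V]
    (n : ℕ) (hdim : finrank ℂ V = 2 * n + 1)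
    (B : V →ₗ[ℂ] V →ₗ[ℂ] ℂ)
    (hsymm : ∀ u v : V, B u v = B v u)
    (hnd : ∀ v : V, (∀ w : V, B v w = 0) → v = 0)
    (y : Module.End ℂ V)
    (hsa : ∀ u v : V, B (y u) v = B u (y v))
    (a : Fin n → ℂ) (b : ℂ)
    (hainj : Function.Injective a) (hab : ∀ i, a i ≠ b)
    (hchar : LinearMap.charpoly y = (∏ i, (X - C (a i)) ^ 2) * (X - C b))
    (heig : ∀ i, finrank ℂ (LinearMap.ker (y - a i • (1 : Module.End ℂ V))) = 1) :
    ∃! U : Submodule ℂ V,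
      finrank ℂ U = n ∧ (∀ u ∈ U, ∀ u' ∈ U, B u u' = 0) ∧ ∀ u ∈ U, y u ∈ U := by
  classical
  have hmult : ∀ μ, finrank ℂ (y.maxGenEigenspace μ) =
      (∑ i, if μ = a i then 2 else 0) + if μ = b then 1 else 0 := fun μ => by
    rw [LinearMap.finrank_maxGenEigenspace_eq, hchar, rootMultiplicity_prod_X_sub_C_sq_mul]
  have hdim_a : ∀ i, finrank ℂ (y.maxGenEigenspace (a i)) = 2 := fun i => by
    simp [hmult, hab i, hainj.eq_iff]
  choose e he0 hespan using fun i => finrank_eq_one_iff'.1 (heig i)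
  have hye : ∀ i, y (e i) = a i • (e i : V) := fun i =>
    sub_eq_zero.1 (LinearMap.mem_ker.1 (e i).2)
  have hind : LinearIndependent ℂ fun i => (e i : V) :=
    Module.End.eigenvectors_linearIndependent' y a hainj _ fun i =>
      ⟨Module.End.mem_eigenspace_iff.2 (hye i), by simpa using he0 i⟩
  let E := Submodule.span ℂ (Set.range fun i => (e i : V))
  have hker_le : ∀ i, LinearMap.ker (y - a i • (1 : Module.End ℂ V)) ≤ E := fun i v hv => by
    obtain ⟨c, hc⟩ := hespan i ⟨v, hv⟩
    have hcv : c • (e i : V) = v := congrArg Subtype.val hc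
    exact hcv ▸ E.smul_mem c (Submodule.subset_span ⟨i, rfl⟩)
  have hEdim : finrank ℂ E = n := by
    simpa using finrank_span_eq_card hind
  refine ⟨E, ⟨hEdim, fun u hu v hv => ?_, fun u hu => ?_⟩, ?_⟩
  · refine LinearMap.BilinMap.apply_apply_mem_of_mem_span ⊥ _ _ B ?_ u v hu hv
    rintro _ ⟨i, rfl⟩ _ ⟨j, rfl⟩
    rcases eq_or_ne i j with rfl | hij
    · exact isotropic_ker_of_lt_finrank hsa (heig i) (by simp [hdim_a]) (e i).2 (e i).2
    · exact orthogonal_of_mem_maxGenEigenspace hsa (hainj.ne hij)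
        (ker_le_maxGenEigenspace y _ (e i).2) (ker_le_maxGenEigenspace y _ (e j).2)
  · refine (Submodule.span_le (p := E.comap y)).2 ?_ hu
    rintro _ ⟨i, rfl⟩
    simpa [hye i] using E.smul_mem (a i) (Submodule.subset_span ⟨i, rfl⟩)
  · rintro U ⟨hUdim, hU, hyU⟩
    refine Submodule.eq_of_le_of_finrank_eq ?_ (hUdim.trans hEdim.symm)
    rw [Submodule.eq_iSup_inf_genEigenspace ⊤ hyU (Module.End.iSup_maxGenEigenspace_eq_top y)]
    refine iSup_le fun μ => ?_
    by_cases hμ : ∃ i, μ = a i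
    · obtain ⟨i, rfl⟩ := hμ
      exact (isotropic_inf_maxGenEigenspace_le_ker hnd hsa hU hyU (heig i) (hdim_a i).le).trans
        (hker_le i)
    · have hle : finrank ℂ (y.maxGenEigenspace μ) ≤ 1 := by
        rw [hmult, Finset.sum_eq_zero fun i _ => if_neg fun h => hμ ⟨i, h⟩]
        split_ifs <;> simp
      suffices U ⊓ y.maxGenEigenspace μ = ⊥ from this.le.trans bot_le
      by_contra hbot
      have hpos := Submodule.one_le_finrank_iff.2 hbot
      have heq := Submodule.eq_of_le_of_finrank_le (inf_le_right : U ⊓ y.maxGenEigenspace μ ≤ _)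
        (hle.trans hpos)
      exact hbot (heq.trans
        (maxGenEigenspace_eq_bot_of_le_isotropic hnd hsa hU (inf_eq_right.1 heq)))
end

section
/- Let V be a complex vector space of dimension 2n with a nondegenerate alternating bilinear form ω, and let x ∈ sp(V, ω) satisfy x ∘ x = 0 and rank x = i. Then the centralizer of x in sp(V, ω), namely { y ∈ End(V) : ω(y u, v) + ω(u, y v) = 0 for all u, v, and y ∘ x = x ∘ y }, has complex dimension n(2n+1) − i(2n+1−i). Equivalently, the Sp(V, ω)-orbit of x has dimension i(2n+1−i). -/
open Module

/-- The centralizer of `x` inside the symplectic Lie algebra `sp(V, ω)`: endomorphisms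
`y` with `ω (y u) v + ω u (y v) = 0` for all `u, v`, commuting with `x`. -/
def spCentralizer {V : Type*} [AddCommGroup V] [Module ℂ V]
    (ω : V →ₗ[ℂ] V →ₗ[ℂ] ℂ) (x : Module.End ℂ V) : Submodule ℂ (Module.End ℂ V) where
  carrier := {y | (∀ u v : V, ω (y u) v + ω u (y v) = 0) ∧ y * x = x * y}
  zero_mem' := by
    refine ⟨fun u v => ?_, by simp⟩
    simp
  add_mem' := by
    rintro a b ⟨ha1, ha2⟩ ⟨hb1, hb2⟩
    refine ⟨fun u v => ?_, by rw [add_mul, mul_add, ha2, hb2]⟩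
    have h1 := ha1 u v
    have h2 := hb1 u v
    simp only [LinearMap.add_apply, map_add]
    linear_combination h1 + h2
  smul_mem' := by
    rintro c a ⟨ha1, ha2⟩
    refine ⟨fun u v => ?_, by rw [smul_mul_assoc, mul_smul_comm, ha2]⟩
    have h1 := ha1 u v
    simp only [LinearMap.smul_apply, map_smul, smul_eq_mul]
    linear_combination c * h1

/-- A square-zero endomorphism of rank `i` has a Jordan basis made of `i` blocks of size two
and `m` blocks of size one. -/
theorem exists_basis_of_mul_self_eq_zero {K V : Type*} [Field K] [AddCommGroup V] [Module K V]
    [FiniteDimensional K V] (x : Module.End K V) (hx : x * x = 0) {i : ℕ}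
    (hrk : finrank K (LinearMap.range x) = i) :
    ∃ (m : ℕ) (b : Basis (Fin i ⊕ (Fin i ⊕ Fin m)) K V),
      (∀ a, x (b (.inl a)) = b (.inr (.inl a))) ∧ ∀ j, x (b (.inr j)) = 0 := by
  have hxx : ∀ v, x (x v) = 0 := fun v => LinearMap.congr_fun hx v
  have hle : LinearMap.range x ≤ LinearMap.ker x := by
    rintro _ ⟨v, rfl⟩
    exact hxx v
  obtain ⟨U, hU⟩ := Submodule.exists_isCompl ((LinearMap.range x).submoduleOf (LinearMap.ker x))
  let r : Basis (Fin i) K (LinearMap.range x) := finBasisOfFinrankEq K _ hrk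
  let u : Basis (Fin (finrank K U)) K U := finBasis K U
  choose w hw using fun a => (r a).2
  have hr : LinearIndependent K (fun a => (r a : V)) :=
    r.linearIndependent.map' (LinearMap.range x).subtype (Submodule.ker_subtype _)
  have hu : LinearIndependent K (fun c => ((u c : LinearMap.ker x) : V)) :=
    (u.linearIndependent.map' U.subtype (Submodule.ker_subtype _)).map'
      (LinearMap.ker x).subtype (Submodule.ker_subtype _)
  have hru : LinearIndependent K
      (Sum.elim (fun a => (r a : V)) (fun c => ((u c : LinearMap.ker x) : V))) := by
    refine hr.sum_type hu (Disjoint.mono (b := LinearMap.range x)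
      (d := U.map (LinearMap.ker x).subtype) ?_ ?_ ?_)
    · rw [Submodule.span_le]
      rintro _ ⟨a, rfl⟩
      exact (r a).2
    · rw [Submodule.span_le]
      rintro _ ⟨c, rfl⟩
      exact ⟨_, (u c).2, rfl⟩
    · rw [Submodule.disjoint_def]
      rintro _ h ⟨z, hz, rfl⟩
      have := Submodule.disjoint_def.1 hU.disjoint z h hz
      simp [this]
  have hw' : LinearIndependent K w := by
    refine LinearIndependent.of_comp x ?_
    have : x ∘ w = fun a => (r a : V) := funext hw
    rwa [this]
  have hli : LinearIndependent K (Sum.elim w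
      (Sum.elim (fun a => (r a : V)) (fun c => ((u c : LinearMap.ker x) : V)))) := by
    refine hw'.sum_type hru (Disjoint.mono_right (c := LinearMap.ker x) ?_ ?_)
    · rw [Submodule.span_le]
      rintro _ ⟨a | c, rfl⟩
      · exact hle (r a).2
      · exact (u c : LinearMap.ker x).2
    · rw [Submodule.disjoint_def]
      intro z hz hxz
      obtain ⟨c, rfl⟩ := (Submodule.mem_span_range_iff_exists_fun K).1 hz
      have h0 : ∑ a, c a • (r a : V) = 0 := by
        simpa [hw] using hxz
      have := Fintype.linearIndependent_iff.1 hr c h0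
      simp [this]
  have hcard : Fintype.card (Fin i ⊕ (Fin i ⊕ Fin (finrank K U))) = finrank K V := by
    have h1 := LinearMap.finrank_range_add_finrank_ker x
    have h2 := Submodule.finrank_add_eq_of_isCompl hU
    have h3 : finrank K ((LinearMap.range x).submoduleOf (LinearMap.ker x)) = i := by
      rw [← hrk]
      exact (Submodule.submoduleOfEquivOfLe hle).finrank_eq
    simp only [Fintype.card_sum, Fintype.card_fin]
    omega
  refine ⟨finrank K U, basisOfLinearIndependentOfCardEqFinrank' _ hli hcard, ?_, ?_⟩
  · simp [hw]
  · rintro (a | c)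
    · simpa using hle (r a).2
    · simp

/-- An element of the symplectic Lie algebra corresponds to a symmetric bilinear form. -/
theorem apply_apply_comm_of_isAlt {K V : Type*} [Field K] [AddCommGroup V] [Module K V]
    {ω : V →ₗ[K] V →ₗ[K] K} (halt : ω.IsAlt) {y : Module.End K V}
    (hy : ∀ u v, ω (y u) v + ω u (y v) = 0) (u v : V) : ω (y u) v = ω (y v) u := by
  rw [eq_neg_of_add_eq_zero_left (hy u v), halt.neg]

/-- Elements of the centralizer of `x` correspond to symmetric forms for which `x` is skew. -/
theorem apply_map_add_apply_map_eq_zero {V : Type*} [AddCommGroup V] [Module ℂ V]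
    {ω : V →ₗ[ℂ] V →ₗ[ℂ] ℂ} {x y : Module.End ℂ V}
    (hsp : ∀ u v : V, ω (x u) v + ω u (x v) = 0) (hy : y ∈ spCentralizer ω x) (u v : V) :
    ω (y (x u)) v + ω (y u) (x v) = 0 := by
  have h : y (x u) = x (y u) := LinearMap.congr_fun hy.2 u
  rw [h, hsp]

/-- A symmetric bilinear form for which `x` is skew comes from an element of the centralizer. -/
theorem exists_mem_spCentralizer {V : Type*} [AddCommGroup V] [Module ℂ V]
    [FiniteDimensional ℂ V] {ω : V →ₗ[ℂ] V →ₗ[ℂ] ℂ} (halt : ω.IsAlt)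
    (hnd : ∀ v : V, (∀ w : V, ω v w = 0) → v = 0) {x : Module.End ℂ V}
    (hsp : ∀ u v : V, ω (x u) v + ω u (x v) = 0) (B : V →ₗ[ℂ] V →ₗ[ℂ] ℂ)
    (hB : ∀ u v, B u v = B v u) (hBx : ∀ u v, B (x u) v + B u (x v) = 0) :
    ∃ y ∈ spCentralizer ω x, ∀ u v, ω (y u) v = B u v := by
  have hinj : Function.Injective ω := by
    rw [← LinearMap.ker_eq_bot, LinearMap.ker_eq_bot']
    exact fun v hv => hnd v fun w => by simp [hv]
  let e : V ≃ₗ[ℂ] Dual ℂ V :=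
    LinearEquiv.ofInjectiveOfFinrankEq ω hinj Subspace.dual_finrank_eq.symm
  have he : ∀ u v, ω (e.symm (B u)) v = B u v := fun u v =>
    LinearMap.congr_fun (e.apply_symm_apply (B u)) v
  refine ⟨e.symm.toLinearMap ∘ₗ B, ⟨fun u v => ?_, ?_⟩, he⟩
  · have h1 := he u v
    have h2 := he v u
    have h3 := halt.neg u (e.symm (B v))
    simp only [LinearMap.comp_apply, LinearEquiv.coe_coe]
    linear_combination h1 - h2 + hB u v - h3
  · ext u
    refine hinj (LinearMap.ext fun v => ?_)
    have h1 := he (x u) v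
    have h2 := he u (x v)
    have h3 := hsp (e.symm (B u)) v
    simp only [Module.End.mul_apply, LinearMap.comp_apply, LinearEquiv.coe_coe]
    linear_combination h1 + h2 - h3 + hBx u v

/-- Coordinates of an element of the centralizer in a Jordan basis of `x`: with
`B u v = ω (y u) v`, the sum of the symmetric matrix `B (w a) (w a')` and the skew-symmetric
matrix `B (w a) (x (w a'))`, the matrix `B (w a) (u c)` and the symmetric matrix
`B (u c) (u c')`. -/
noncomputable def spCentralizerCoords {V : Type*} [AddCommGroup V] [Module ℂ V]
    (ω : V →ₗ[ℂ] V →ₗ[ℂ] ℂ) (halt : ω.IsAlt) (x : Module.End ℂ V) {i m : ℕ}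
    (b : Basis (Fin i ⊕ (Fin i ⊕ Fin m)) ℂ V) :
    spCentralizer ω x →ₗ[ℂ]
      (Fin i × Fin i → ℂ) × (Fin i × Fin m → ℂ) × (Sym2 (Fin m) → ℂ) where
  toFun y :=
    (fun p => ω (y.1 (b (.inl p.1))) (b (.inl p.2)) + ω (y.1 (b (.inl p.1))) (b (.inr (.inl p.2))),
      fun p => ω (y.1 (b (.inl p.1))) (b (.inr (.inr p.2))),
      Sym2.lift ⟨fun c d => ω (y.1 (b (.inr (.inr c)))) (b (.inr (.inr d))),
        fun _ _ => apply_apply_comm_of_isAlt halt y.2.1 _ _⟩)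
  map_add' y z := by
    refine Prod.ext ?_ (Prod.ext ?_ ?_)
    · funext p
      simp only [Submodule.coe_add, LinearMap.add_apply, map_add, Prod.fst_add, Pi.add_apply]
      ring
    · funext p
      simp
    · funext p
      induction p with | _ c d => simp
  map_smul' t y := by
    refine Prod.ext ?_ (Prod.ext ?_ ?_)
    · funext p
      simp [mul_add]
    · funext p
      simp
    · funext p
      induction p with | _ c d => simp

theorem spCentralizerCoords_injective {V : Type*} [AddCommGroup V] [Module ℂ V]
    (ω : V →ₗ[ℂ] V →ₗ[ℂ] ℂ) (halt : ω.IsAlt)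
    (hnd : ∀ v : V, (∀ w : V, ω v w = 0) → v = 0) (x : Module.End ℂ V)
    (hsp : ∀ u v : V, ω (x u) v + ω u (x v) = 0) {i m : ℕ}
    (b : Basis (Fin i ⊕ (Fin i ⊕ Fin m)) ℂ V)
    (hb : ∀ a, x (b (.inl a)) = b (.inr (.inl a))) (hb' : ∀ j, x (b (.inr j)) = 0) :
    Function.Injective (spCentralizerCoords ω halt x b) := by
  rw [← LinearMap.ker_eq_bot, LinearMap.ker_eq_bot']
  rintro ⟨y, hy⟩ h
  have hs := apply_apply_comm_of_isAlt halt hy.1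
  have hx := apply_map_add_apply_map_eq_zero hsp hy
  have h1 : ∀ a a', ω (y (b (.inl a))) (b (.inl a')) +
      ω (y (b (.inl a))) (b (.inr (.inl a'))) = 0 := fun a a' =>
    congrFun (congrArg Prod.fst h) (a, a')
  have h2 : ∀ a c, ω (y (b (.inl a))) (b (.inr (.inr c))) = 0 := fun a c =>
    congrFun (congrArg (fun p => p.2.1) h) (a, c)
  have h3 : ∀ c d, ω (y (b (.inr (.inr c)))) (b (.inr (.inr d))) = 0 := fun c d =>
    congrFun (congrArg (fun p => p.2.2) h) s(c, d)
  have hskew : ∀ a a', ω (y (b (.inl a'))) (b (.inr (.inl a))) +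
      ω (y (b (.inl a))) (b (.inr (.inl a'))) = 0 := fun a a' => by
    have := hx (b (.inl a)) (b (.inl a'))
    rwa [hb, hb, hs] at this
  have hww : ∀ a a', ω (y (b (.inl a))) (b (.inl a')) = 0 := fun a a' => by
    linear_combination (h1 a a' + h1 a' a - hskew a a' + hs (b (.inl a)) (b (.inl a'))) / 2
  have hwr : ∀ a a', ω (y (b (.inl a))) (b (.inr (.inl a'))) = 0 := fun a a' => by
    linear_combination h1 a a' - hww a a'
  have hr : ∀ a j, ω (y (b (.inr (.inl a)))) (b (.inr j)) = 0 := fun a j => by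
    have := hx (b (.inl a)) (b (.inr j))
    rwa [hb, hb', map_zero, add_zero] at this
  have hB : ω ∘ₗ y = 0 := by
    refine b.ext fun j => b.ext fun k => ?_
    simp only [LinearMap.comp_apply, LinearMap.zero_apply]
    rcases j with a | a | c <;> rcases k with a' | a' | c'
    · exact hww a a'
    · exact hwr a a'
    · exact h2 a c'
    · exact (hs _ _).trans (hwr a' a)
    · exact hr _ _
    · exact hr _ _
    · exact (hs _ _).trans (h2 a' c)
    · exact (hs _ _).trans (hr _ _)
    · exact h3 c c'
  refine Subtype.ext (LinearMap.ext fun v => hnd _ fun w => ?_)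
  exact LinearMap.congr_fun (LinearMap.congr_fun hB v) w

theorem spCentralizerCoords_surjective {V : Type*} [AddCommGroup V] [Module ℂ V]
    [FiniteDimensional ℂ V] (ω : V →ₗ[ℂ] V →ₗ[ℂ] ℂ) (halt : ω.IsAlt)
    (hnd : ∀ v : V, (∀ w : V, ω v w = 0) → v = 0) (x : Module.End ℂ V)
    (hsp : ∀ u v : V, ω (x u) v + ω u (x v) = 0) {i m : ℕ}
    (b : Basis (Fin i ⊕ (Fin i ⊕ Fin m)) ℂ V)
    (hb : ∀ a, x (b (.inl a)) = b (.inr (.inl a))) (hb' : ∀ j, x (b (.inr j)) = 0) :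
    Function.Surjective (spCentralizerCoords ω halt x b) := by
  rintro ⟨M, E, S⟩
  let β : Fin i ⊕ (Fin i ⊕ Fin m) → Fin i ⊕ (Fin i ⊕ Fin m) → ℂ
    | .inl a, .inl a' => (M (a, a') + M (a', a)) / 2
    | .inl a, .inr (.inl a') => (M (a, a') - M (a', a)) / 2
    | .inl a, .inr (.inr c) => E (a, c)
    | .inr (.inl a), .inl a' => (M (a', a) - M (a, a')) / 2
    | .inr (.inl _), .inr _ => 0
    | .inr (.inr c), .inl a => E (a, c)
    | .inr (.inr _), .inr (.inl _) => 0
    | .inr (.inr c), .inr (.inr d) => S s(c, d)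
  let B : V →ₗ[ℂ] V →ₗ[ℂ] ℂ := b.constr ℂ fun j => b.constr ℂ (β j)
  have hBb : ∀ j k, B (b j) (b k) = β j k := fun j k => by simp [B]
  have hB : B = B.flip := by
    refine b.ext fun j => b.ext fun k => ?_
    rw [LinearMap.flip_apply, hBb, hBb]
    rcases j with a | a | c <;> rcases k with a' | a' | c' <;> simp only [β]
    · ring
    · rw [Sym2.eq_swap]
  have hBx : B ∘ₗ x + B.compl₂ x = 0 := by
    refine b.ext fun j => b.ext fun k => ?_
    simp only [LinearMap.add_apply, LinearMap.comp_apply, LinearMap.compl₂_apply,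
      LinearMap.zero_apply]
    rcases j with a | j <;> rcases k with a' | k <;>
      simp only [hb, hb', hBb, map_zero, LinearMap.zero_apply, add_zero, zero_add]
    · simp only [β]
      ring
    · simp only [β]
    · rcases j with j | j <;> simp only [β]
  obtain ⟨y, hy, hyB⟩ := exists_mem_spCentralizer halt hnd hsp B
    (fun u v => LinearMap.congr_fun (LinearMap.congr_fun hB u) v)
    (fun u v => LinearMap.congr_fun (LinearMap.congr_fun hBx u) v)
  refine ⟨⟨y, hy⟩, Prod.ext ?_ (Prod.ext ?_ ?_)⟩
  · funext p
    simp only [spCentralizerCoords, LinearMap.coe_mk, AddHom.coe_mk, hyB, hBb, β]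
    ring
  · funext p
    simp only [spCentralizerCoords, LinearMap.coe_mk, AddHom.coe_mk, hyB, hBb, β]
  · funext p
    induction p with
    | _ c d => simp only [spCentralizerCoords, LinearMap.coe_mk, AddHom.coe_mk, Sym2.lift_mk,
        hyB, hBb, β]

/-- Let `dim V = 2n`, `ω` a nondegenerate alternating form on `V`,
`x ∈ sp(V, ω)` with `x² = 0` and `rank x = i`.  Then the centralizer of `x` in
`sp(V, ω)` has dimension `n(2n+1) − i(2n+1−i)`. -/
theorem stmt_15 {V : Type*} [AddCommGroup V] [Module ℂ V] [FiniteDimensional ℂ V]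
    (n : ℕ) (hdim : finrank ℂ V = 2 * n)
    (ω : V →ₗ[ℂ] V →ₗ[ℂ] ℂ)
    (halt : ∀ v : V, ω v v = 0)
    (hnd : ∀ v : V, (∀ w : V, ω v w = 0) → v = 0)
    (x : Module.End ℂ V)
    (hsp : ∀ u v : V, ω (x u) v + ω u (x v) = 0)
    (hx2 : x * x = 0)
    (i : ℕ) (hrk : finrank ℂ (LinearMap.range x) = i) :
    finrank ℂ (spCentralizer ω x) = n * (2 * n + 1) - i * (2 * n + 1 - i) := by
  obtain ⟨m, b, hb, hb'⟩ := exists_basis_of_mul_self_eq_zero x hx2 hrk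
  have hcard : i + (i + m) = 2 * n := by
    simpa [hdim] using (finrank_eq_card_basis b).symm
  obtain ⟨k, rfl⟩ : ∃ k, n = i + k := ⟨n - i, by omega⟩
  obtain rfl : m = 2 * k := by omega
  rw [(LinearEquiv.ofBijective (spCentralizerCoords ω halt x b)
    ⟨spCentralizerCoords_injective ω halt hnd x hsp b hb hb',
      spCentralizerCoords_surjective ω halt hnd x hsp b hb hb'⟩).finrank_eq]
  have hS : (2 * k + 1).choose 2 = k * (2 * k + 1) := by
    rw [Nat.choose_two_right, Nat.add_sub_cancel,
      show (2 * k + 1) * (2 * k) = k * (2 * k + 1) * 2 by ring, Nat.mul_div_cancel _ two_pos]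
  have hi : 2 * (i + k) + 1 - i = i + 2 * k + 1 := by omega
  simp only [finrank_prod, finrank_fintype_fun_eq_card, Fintype.card_prod, Fintype.card_fin,
    Sym2.card, hS, hi]
  refine (Nat.sub_eq_of_eq_add ?_).symm
  ring
end
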